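/- In an arbitrage-free discrete market model with proportional transaction costs, for an American option with adapted ℝ²-valued payoff process (ξ,ζ), the seller's price satisfies π^a(ξ,ζ) = sup over mixed stopping times χ of the supremum over pairs (P,S) ∈ P(χ) of E_P((ξ + Sζ)_χ), where P(χ) consists of the pairs in barP(χ) whose probability measure is equivalent to Q; moreover the supremum over χ is attained. -/

import Mathlib

open MeasureTheory
open scoped Pointwise

noncomputable section

namespace RZ

variable {Ω : Type*} [Fintype Ω]

/-- `ω` and `ω'` lie in the same atom of the σ-field `m`. -/
def sameAtom (m : MeasurableSpace Ω) (ω ω' : Ω) : Prop :=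
  ∀ A : Set Ω, MeasurableSet[m] A → (ω ∈ A ↔ ω' ∈ A)

/-- Elementary conditional expectation w.r.t. a σ-field on a finite space:
at `ω` it is the `P`-average of `f` over the atom of `ω`. -/
def condExp (m : MeasurableSpace Ω) (P : Ω → ℝ) (f : Ω → ℝ) (ω : Ω) : ℝ :=
  (∑ ω' : Ω, Set.indicator {ω'' | sameAtom m ω ω''} (fun ω'' => P ω'' * f ω'') ω') /
  (∑ ω' : Ω, Set.indicator {ω'' | sameAtom m ω ω''} P ω')

/-- Expectation under `P`. -/
def expect (P : Ω → ℝ) (f : Ω → ℝ) : ℝ := ∑ ω : Ω, P ω * f ω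

/-- Discrete market model with proportional transaction costs. -/
structure Market (Ω : Type*) [Fintype Ω] where
  T : ℕ
  T_pos : 0 < T
  F : ℕ → MeasurableSpace Ω
  F_mono : ∀ ⦃s t : ℕ⦄, s ≤ t → F s ≤ F t
  F_zero : F 0 = ⊥
  F_top : F T = ⊤
  Q : Ω → ℝ
  Q_pos : ∀ ω, 0 < Q ω
  Q_sum : ∑ ω, Q ω = 1
  Sb : ℕ → Ω → ℝ
  Sa : ℕ → Ω → ℝ
  Sb_pos : ∀ t ω, t ≤ T → 0 < Sb t ω
  Sb_le_Sa : ∀ t ω, t ≤ T → Sb t ω ≤ Sa t ω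
  Sb_adapted : ∀ t, t ≤ T → Measurable[F t] (Sb t)
  Sa_adapted : ∀ t, t ≤ T → Measurable[F t] (Sa t)

variable (M : Market Ω)

/-- Liquidation value θ_t(γ, δ) in scenario ω, for a cash position γ and stock position δ. -/
def liq (t : ℕ) (ω : Ω) (γ δ : ℝ) : ℝ :=
  γ + M.Sb t ω * max δ 0 - M.Sa t ω * max (-δ) 0

/-- An adapted (real-valued) process. -/
def IsAdapted (X : ℕ → Ω → ℝ) : Prop := ∀ t, t ≤ M.T → Measurable[M.F t] (X t)

/-- An adapted ℝ²-valued payoff process. -/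
def AdaptedPair (ξ ζ : ℕ → Ω → ℝ) : Prop := IsAdapted M ξ ∧ IsAdapted M ζ

/-- Self-financing strategy. -/
def SelfFinancing (α β : ℕ → Ω → ℝ) : Prop :=
  Measurable[M.F 0] (α 0) ∧ Measurable[M.F 0] (β 0) ∧
  (∀ t, t < M.T → Measurable[M.F t] (α (t + 1)) ∧ Measurable[M.F t] (β (t + 1))) ∧
  (∀ t, t < M.T → ∀ ω, 0 ≤ liq M t ω (α t ω - α (t + 1) ω) (β t ω - β (t + 1) ω))

/-- Pure stopping time with values in {0,...,T}. -/
def IsStop (τ : Ω → ℕ) : Prop :=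
  (∀ ω, τ ω ≤ M.T) ∧ ∀ t : ℕ, MeasurableSet[M.F t] {ω | τ ω = t}

/-- Seller superhedging strategy. -/
def SellerHedge (ξ ζ α β : ℕ → Ω → ℝ) : Prop :=
  SelfFinancing M α β ∧
  ∀ τ, IsStop M τ → ∀ ω,
    0 ≤ liq M (τ ω) ω (α (τ ω) ω - ξ (τ ω) ω) (β (τ ω) ω - ζ (τ ω) ω)

/-- Buyer superhedging strategy. -/
def BuyerHedge (ξ ζ α β : ℕ → Ω → ℝ) : Prop :=
  SelfFinancing M α β ∧
  ∃ τ, IsStop M τ ∧ ∀ ω,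
    0 ≤ liq M (τ ω) ω (α (τ ω) ω + ξ (τ ω) ω) (β (τ ω) ω + ζ (τ ω) ω)

/-- Seller's (ask) price: infimum of the initial costs of seller superhedging strategies. -/
def askPrice (ξ ζ : ℕ → Ω → ℝ) : ℝ :=
  sInf {x | ∃ α β, SellerHedge M ξ ζ α β ∧ ∀ ω, x = -liq M 0 ω (-α 0 ω) (-β 0 ω)}

/-- Buyer's (bid) price: supremum of the amounts raised by buyer superhedging strategies. -/
def bidPrice (ξ ζ : ℕ → Ω → ℝ) : ℝ :=
  sSup {x | ∃ α β, BuyerHedge M ξ ζ α β ∧ ∀ ω, x = liq M 0 ω (-α 0 ω) (-β 0 ω)}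

/-- Mixed stopping time. -/
def IsMixedStop (χ : ℕ → Ω → ℝ) : Prop :=
  (∀ t, t ≤ M.T → Measurable[M.F t] (χ t)) ∧ (∀ t ω, 0 ≤ χ t ω) ∧
  ∀ ω, ∑ t ∈ Finset.range (M.T + 1), χ t ω = 1

/-- χ*_t = Σ_{s=t}^T χ_s  (so χ*_{T+1} = 0). -/
def chiStar (χ : ℕ → Ω → ℝ) (t : ℕ) (ω : Ω) : ℝ := ∑ s ∈ Finset.Icc t M.T, χ s ω

/-- Z^{χ*}_t = Σ_{s=t}^T χ_s Z_s  (so Z^{χ*}_{T+1} = 0). -/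
def starVal (χ Z : ℕ → Ω → ℝ) (t : ℕ) (ω : Ω) : ℝ :=
  ∑ s ∈ Finset.Icc t M.T, χ s ω * Z s ω

/-- Z_χ = Σ_{t=0}^T χ_t Z_t. -/
def mixVal (χ Z : ℕ → Ω → ℝ) (ω : Ω) : ℝ :=
  ∑ t ∈ Finset.range (M.T + 1), χ t ω * Z t ω

/-- Membership in the family barP(χ). -/
def memBarP (χ : ℕ → Ω → ℝ) (P : Ω → ℝ) (S : ℕ → Ω → ℝ) : Prop :=
  (∀ ω, 0 ≤ P ω) ∧ (∑ ω, P ω) = 1 ∧ IsAdapted M S ∧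
  (∀ t ω, t ≤ M.T → M.Sb t ω ≤ S t ω ∧ S t ω ≤ M.Sa t ω) ∧
  (∀ t, t ≤ M.T → ∀ ω, 0 < P ω →
    chiStar M χ (t + 1) ω * M.Sb t ω ≤ condExp (M.F t) P (starVal M χ S (t + 1)) ω ∧
    condExp (M.F t) P (starVal M χ S (t + 1)) ω ≤ chiStar M χ (t + 1) ω * M.Sa t ω)

/-- Membership in the family P(χ): barP(χ) with P equivalent to Q. -/
def memP (χ : ℕ → Ω → ℝ) (P : Ω → ℝ) (S : ℕ → Ω → ℝ) : Prop :=
  memBarP M χ P S ∧ ∀ ω, 0 < P ω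

/-- The mixed stopping time χ^τ associated with a pure stopping time τ. -/
def pureChi (τ : Ω → ℕ) : ℕ → Ω → ℝ := fun t ω => if τ ω = t then 1 else 0

/-- Arbitrage-free: there is an equivalent probability measure and a martingale
between the bid and ask prices. -/
def ArbitrageFree : Prop :=
  ∃ (P : Ω → ℝ) (S : ℕ → Ω → ℝ),
    (∀ ω, 0 < P ω) ∧ (∑ ω, P ω) = 1 ∧ IsAdapted M S ∧
    (∀ t ω, t ≤ M.T → M.Sb t ω ≤ S t ω ∧ S t ω ≤ M.Sa t ω) ∧
    (∀ t, t < M.T → ∀ ω, 0 < P ω → condExp (M.F t) P (S (t + 1)) ω = S t ω)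

/-- Epigraph of a function ℝ → ℝ, as a subset of ℝ² (first coordinate dominates). -/
def epi (f : ℝ → ℝ) : Set (ℝ × ℝ) := {p | f p.2 ≤ p.1}

/-- The function h_{[b,a]}(y) = a y⁻ − b y⁺. -/
def hfun (b a : ℝ) (y : ℝ) : ℝ := a * max (-y) 0 - b * max y 0

/-- Seller's payoff function u_t(y) = ξ_t + (y − ζ_t)⁻ S^a_t − (y − ζ_t)⁺ S^b_t. -/
def uSell (ξ ζ : ℕ → Ω → ℝ) (t : ℕ) (ω : Ω) (y : ℝ) : ℝ :=
  ξ t ω + M.Sa t ω * max (ζ t ω - y) 0 - M.Sb t ω * max (y - ζ t ω) 0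

/-- Buyer's payoff function u_t(y) = −ξ_t + (y + ζ_t)⁻ S^a_t − (y + ζ_t)⁺ S^b_t. -/
def uBuy (ξ ζ : ℕ → Ω → ℝ) (t : ℕ) (ω : Ω) (y : ℝ) : ℝ :=
  -ξ t ω + M.Sa t ω * max (-(y + ζ t ω)) 0 - M.Sb t ω * max (y + ζ t ω) 0

/-- The seller's pricing recursion: one function per atom,
`z_T = u_T` and `epi z_{t-1} = epi u_{t-1} ∩ (epi h + ⋂_{succ} epi z_t)`. -/
def SellerRec (ξ ζ : ℕ → Ω → ℝ) (z : ℕ → Ω → ℝ → ℝ) : Prop :=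
  (∀ t ω ω', t ≤ M.T → sameAtom (M.F t) ω ω' → z t ω = z t ω') ∧
  (∀ ω, z M.T ω = uSell M ξ ζ M.T ω) ∧
  (∀ t ω, t < M.T →
    epi (z t ω) = epi (uSell M ξ ζ t ω) ∩
      (epi (hfun (M.Sb t ω) (M.Sa t ω)) +
        ⋂ ω' ∈ {ω'' | sameAtom (M.F t) ω ω''}, epi (z (t + 1) ω')))

/-- The buyer's pricing recursion: one function per atom,
`z_T = u_T` and `epi z_{t-1} = epi u_{t-1} ∪ (epi h + ⋂_{succ} epi z_t)`. -/
def BuyerRec (ξ ζ : ℕ → Ω → ℝ) (z : ℕ → Ω → ℝ → ℝ) : Prop :=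
  (∀ t ω ω', t ≤ M.T → sameAtom (M.F t) ω ω' → z t ω = z t ω') ∧
  (∀ ω, z M.T ω = uBuy M ξ ζ M.T ω) ∧
  (∀ t ω, t < M.T →
    epi (z t ω) = epi (uBuy M ξ ζ t ω) ∪
      (epi (hfun (M.Sb t ω) (M.Sa t ω)) +
        ⋂ ω' ∈ {ω'' | sameAtom (M.F t) ω ω''}, epi (z (t + 1) ω')))

section Atoms

variable {Ω : Type*}

lemma sameAtom_iff_mem_measurableAtom (m : MeasurableSpace Ω) (ω ω' : Ω) :
    sameAtom m ω ω' ↔ ω' ∈ @measurableAtom Ω m ω := by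
  constructor
  · intro h
    simp only [measurableAtom, Set.mem_iInter]
    exact fun s hs hm => (h s hm).1 hs
  · intro h A hA
    refine ⟨fun hω => @mem_of_mem_measurableAtom Ω m _ _ h _ hA hω, fun hω' => ?_⟩
    by_contra hω
    exact @mem_of_mem_measurableAtom Ω m _ _ h _ hA.compl hω hω'

lemma sameAtom_refl (m : MeasurableSpace Ω) (ω : Ω) : sameAtom m ω ω := fun _ _ => Iff.rfl

lemma sameAtom.symm {m : MeasurableSpace Ω} {ω ω' : Ω} (h : sameAtom m ω ω') :
    sameAtom m ω' ω := fun A hA => (h A hA).symm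

lemma sameAtom.trans {m : MeasurableSpace Ω} {ω ω' ω'' : Ω} (h : sameAtom m ω ω')
    (h' : sameAtom m ω' ω'') : sameAtom m ω ω'' := fun A hA => (h A hA).trans (h' A hA)

lemma sameAtom.mono {m m' : MeasurableSpace Ω} (hm : m ≤ m') {ω ω' : Ω} (h : sameAtom m' ω ω') :
    sameAtom m ω ω' := fun A hA => h A (hm A hA)

/-- `f` is constant on the atoms of `m`. -/
def AtomConst (m : MeasurableSpace Ω) (f : Ω → ℝ) : Prop :=
  ∀ ω ω', sameAtom m ω ω' → f ω = f ω'

lemma AtomConst.mono {m m' : MeasurableSpace Ω} (hm : m ≤ m') {f : Ω → ℝ} (hf : AtomConst m f) :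
    AtomConst m' f := fun ω ω' h => hf ω ω' (h.mono hm)

lemma measurable_iff_atomConst [Finite Ω] (m : MeasurableSpace Ω) (f : Ω → ℝ) :
    Measurable[m] f ↔ AtomConst m f := by
  constructor
  · intro hf ω ω' h
    exact ((h _ (hf (measurableSet_singleton (f ω)))).1 rfl : f ω' = f ω).symm
  · intro hf s _
    have : f ⁻¹' s = ⋃ ω ∈ f ⁻¹' s, @measurableAtom Ω m ω := by
      ext ω'
      simp only [Set.mem_iUnion, exists_prop]
      refine ⟨fun h => ⟨ω', h, @mem_measurableAtom_self Ω m ω'⟩, ?_⟩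
      rintro ⟨ω, hω, h⟩
      have := hf ω ω' ((sameAtom_iff_mem_measurableAtom m ω ω').2 h)
      simpa [Set.mem_preimage, ← this] using hω
    rw [this]
    exact MeasurableSet.biUnion (Set.to_countable _)
      fun ω _ => @MeasurableSet.measurableAtom_of_countable Ω m _ ω

lemma AtomConst.eq_of_bot {f : Ω → ℝ} (hf : AtomConst ⊥ f) (ω ω' : Ω) : f ω = f ω' := by
  refine hf ω ω' fun A hA => ?_
  rcases MeasurableSpace.measurableSet_bot_iff.1 hA with rfl | rfl <;> simp

open Classical in
/-- The indicator function of the atom of `ω`. -/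
def atomInd (m : MeasurableSpace Ω) (ω ω' : Ω) : ℝ := if sameAtom m ω ω' then 1 else 0

lemma atomInd_congr {m : MeasurableSpace Ω} {ω₁ ω₂ ω₃ ω₄ : Ω}
    (h : sameAtom m ω₁ ω₂ ↔ sameAtom m ω₃ ω₄) : atomInd m ω₁ ω₂ = atomInd m ω₃ ω₄ := by
  unfold atomInd
  split_ifs <;> tauto

lemma atomInd_nonneg (m : MeasurableSpace Ω) (ω ω' : Ω) : 0 ≤ atomInd m ω ω' := by
  unfold atomInd
  split_ifs <;> norm_num

lemma atomInd_self (m : MeasurableSpace Ω) (ω : Ω) : atomInd m ω ω = 1 := by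
  simp [atomInd, sameAtom_refl]

lemma atomInd_comm (m : MeasurableSpace Ω) (ω ω' : Ω) : atomInd m ω ω' = atomInd m ω' ω :=
  atomInd_congr ⟨sameAtom.symm, sameAtom.symm⟩

/-- On the atom of `ω`, a measurable function takes its value at `ω`. -/
lemma AtomConst.mul_atomInd {m : MeasurableSpace Ω} {f : Ω → ℝ} (hf : AtomConst m f) (ω ω' : Ω) :
    f ω' * atomInd m ω ω' = f ω * atomInd m ω ω' := by
  by_cases h : sameAtom m ω ω'
  · rw [hf _ _ h]
  · simp [atomInd, h]

lemma atomConst_atomInd (m : MeasurableSpace Ω) (ω : Ω) : AtomConst m (atomInd m ω) := by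
  exact fun ω₁ ω₂ h => atomInd_congr ⟨fun h' => h'.trans h, fun h' => h'.trans h.symm⟩

end Atoms

lemma condExp_eq (m : MeasurableSpace Ω) (P f : Ω → ℝ) (ω : Ω) :
    condExp m P f ω = (∑ ω', P ω' * f ω' * atomInd m ω ω') / ∑ ω', P ω' * atomInd m ω ω' := by
  classical
  simp only [condExp, Set.indicator_apply, Set.mem_ofPred_eq, atomInd, mul_ite, mul_one, mul_zero]

lemma atomConst_condExp (m : MeasurableSpace Ω) (P f : Ω → ℝ) : AtomConst m (condExp m P f) := by
  intro ω₁ ω₂ h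
  have : ∀ ω', atomInd m ω₁ ω' = atomInd m ω₂ ω' := fun ω' =>
    atomInd_congr ⟨fun h' => h.symm.trans h', fun h' => h.trans h'⟩
  simp only [condExp_eq, this]

lemma sum_mul_condExp (m : MeasurableSpace Ω) {P : Ω → ℝ} (hP : ∀ ω, 0 ≤ P ω) (f : Ω → ℝ)
    {φ : Ω → ℝ} (hφ : AtomConst m φ) :
    ∑ ω, P ω * (φ ω * condExp m P f ω) = ∑ ω, P ω * (φ ω * f ω) := by
  set N : Ω → ℝ := fun ω => ∑ ω', P ω' * atomInd m ω ω' with hN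
  have key : ∀ ω ω', P ω * (φ ω * (P ω' * f ω' * atomInd m ω ω' / N ω)) =
      P ω' * (φ ω' * f ω') / N ω' * (P ω * atomInd m ω' ω) := by
    intro ω ω'
    by_cases h : sameAtom m ω ω'
    · have h1 : φ ω = φ ω' := hφ _ _ h
      have h2 : N ω = N ω' := by
        simp only [hN]
        refine Finset.sum_congr rfl fun ω'' _ => ?_
        rw [atomInd_comm m ω, atomInd_comm m ω', atomConst_atomInd m ω'' _ _ h]
      rw [h1, h2, atomInd_comm m ω' ω]
      ring
    · have h0 : atomInd m ω ω' = 0 := by simp [atomInd, h]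
      rw [← atomInd_comm m ω ω', h0]; simp
  calc ∑ ω, P ω * (φ ω * condExp m P f ω)
      = ∑ ω, ∑ ω', P ω * (φ ω * (P ω' * f ω' * atomInd m ω ω' / N ω)) := by
        refine Finset.sum_congr rfl fun ω _ => ?_
        rw [condExp_eq, Finset.sum_div, Finset.mul_sum, Finset.mul_sum]
    _ = ∑ ω', ∑ ω, P ω' * (φ ω' * f ω') / N ω' * (P ω * atomInd m ω' ω) := by
        rw [Finset.sum_comm]
        exact Finset.sum_congr rfl fun ω' _ => Finset.sum_congr rfl fun ω _ => key ω ω'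
    _ = ∑ ω', P ω' * (φ ω' * f ω') := by
        refine Finset.sum_congr rfl fun ω' _ => ?_
        rw [← Finset.mul_sum]
        change P ω' * (φ ω' * f ω') / N ω' * N ω' = _
        by_cases hz : N ω' = 0
        · have hnn : ∀ ω ∈ Finset.univ, 0 ≤ P ω * atomInd m ω' ω := fun ω _ =>
            mul_nonneg (hP ω) (atomInd_nonneg m ω' ω)
          have := (Finset.sum_eq_zero_iff_of_nonneg hnn).1 hz ω' (Finset.mem_univ _)
          have h0 : P ω' = 0 := by simpa [atomInd_self] using this
          simp [h0]
        · exact div_mul_cancel₀ _ hz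

lemma sum_mul_atomInd_pos (m : MeasurableSpace Ω) {P : Ω → ℝ} (hP : ∀ ω, 0 ≤ P ω) {ω : Ω}
    (hω : 0 < P ω) : 0 < ∑ ω', P ω' * atomInd m ω ω' :=
  Finset.sum_pos' (fun ω' _ => mul_nonneg (hP ω') (atomInd_nonneg m ω ω'))
    ⟨ω, Finset.mem_univ _, by rw [atomInd_self, mul_one]; exact hω⟩

lemma le_condExp {m : MeasurableSpace Ω} {P f a : Ω → ℝ} (hP : ∀ ω, 0 ≤ P ω) (ha : AtomConst m a)
    (h : ∀ ω, a ω ≤ f ω) {ω : Ω} (hω : 0 < P ω) : a ω ≤ condExp m P f ω := by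
  rw [condExp_eq, le_div_iff₀ (sum_mul_atomInd_pos m hP hω), Finset.mul_sum]
  refine Finset.sum_le_sum fun ω' _ => ?_
  have := mul_le_mul_of_nonneg_left (h ω') (mul_nonneg (hP ω') (atomInd_nonneg m ω ω'))
  linear_combination this - P ω' * ha.mul_atomInd ω ω'

lemma condExp_le {m : MeasurableSpace Ω} {P f a : Ω → ℝ} (hP : ∀ ω, 0 ≤ P ω) (ha : AtomConst m a)
    (h : ∀ ω, f ω ≤ a ω) {ω : Ω} (hω : 0 < P ω) : condExp m P f ω ≤ a ω := by
  rw [condExp_eq, div_le_iff₀ (sum_mul_atomInd_pos m hP hω), Finset.mul_sum]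
  refine Finset.sum_le_sum fun ω' _ => ?_
  have := mul_le_mul_of_nonneg_left (h ω') (mul_nonneg (hP ω') (atomInd_nonneg m ω ω'))
  linear_combination this + P ω' * ha.mul_atomInd ω ω'

/-- Every nonnegative function may be replaced by an `m`-measurable one without changing its
sums against `m`-measurable functions. -/
lemma exists_average (m : MeasurableSpace Ω) {f : Ω → ℝ} (hf : ∀ ω, 0 ≤ f ω) :
    ∃ g : Ω → ℝ, AtomConst m g ∧ (∀ ω, 0 ≤ g ω) ∧
      ∀ φ : Ω → ℝ, AtomConst m φ → ∑ ω, φ ω * g ω = ∑ ω, φ ω * f ω := by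
  refine ⟨condExp m (fun _ => 1) f, atomConst_condExp _ _ _, fun ω => ?_, fun φ hφ => ?_⟩
  · rw [condExp_eq]
    have h := atomInd_nonneg m ω
    exact div_nonneg (Finset.sum_nonneg fun ω' _ => mul_nonneg (mul_nonneg zero_le_one (hf _)) (h _))
      (Finset.sum_nonneg fun ω' _ => mul_nonneg zero_le_one (h _))
  · simpa using sum_mul_condExp m (P := fun _ => 1) (fun _ => zero_le_one) f hφ

/-- Farkas' lemma over an arbitrary real vector space. -/
lemma farkas_finset {ι V : Type*} [AddCommGroup V] [Module ℝ V] (s : Finset ι) :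
    ∀ (g : ι → V →ₗ[ℝ] ℝ) (f : V →ₗ[ℝ] ℝ), (∀ z, (∀ i ∈ s, 0 ≤ g i z) → 0 ≤ f z) →
      ∃ y : ι → ℝ, (∀ i, 0 ≤ y i) ∧ ∀ z, f z = ∑ i ∈ s, y i * g i z := by
  classical
  induction s using Finset.induction_on with
  | empty =>
    intro g f h
    refine ⟨0, fun _ => le_rfl, fun z => ?_⟩
    have h1 := h z (by simp)
    have h2 := h (-z) (by simp)
    rw [map_neg] at h2
    simp only [Finset.sum_empty]
    linarith
  | insert j s hj ih =>
    intro g f h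
    by_cases hs : ∀ z, (∀ i ∈ s, 0 ≤ g i z) → 0 ≤ f z
    · obtain ⟨y, hy, hf⟩ := ih g f hs
      refine ⟨fun i => if i = j then 0 else y i, fun i => ?_, fun z => ?_⟩
      · dsimp only; split_ifs <;> simp [hy]
      · rw [Finset.sum_insert hj, hf z]
        simp only [if_true, zero_mul, zero_add]
        exact Finset.sum_congr rfl fun i hi => by rw [if_neg (ne_of_mem_of_not_mem hi hj)]
    push Not at hs
    obtain ⟨z₁, hz₁, hfz₁⟩ := hs
    have hg₁ : g j z₁ < 0 := by
      by_contra hc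
      push Not at hc
      refine absurd (h z₁ fun i hi => ?_) (not_le.2 hfz₁)
      rcases Finset.mem_insert.1 hi with rfl | hi
      · exact hc
      · exact hz₁ i hi
    obtain ⟨z₀, hz₀, hfz₀, hg₀⟩ : ∃ z₀, (∀ i ∈ s, 0 ≤ g i z₀) ∧ f z₀ < 0 ∧ g j z₀ = -1 := by
      have hc : 0 < (-g j z₁)⁻¹ := inv_pos.2 (by linarith)
      refine ⟨(-g j z₁)⁻¹ • z₁, fun i hi => ?_, ?_, ?_⟩
      · rw [map_smul, smul_eq_mul]; exact mul_nonneg hc.le (hz₁ i hi)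
      · rw [map_smul, smul_eq_mul]; exact mul_neg_of_pos_of_neg hc hfz₁
      · rw [map_smul, smul_eq_mul]
        field_simp [hg₁.ne]
    obtain ⟨y, hy, hf⟩ := ih (fun i => g i + (g i z₀) • g j) (f + (f z₀) • g j) (by
      intro z hz
      have := h (z + (g j z) • z₀) (by
        intro i hi
        rcases Finset.mem_insert.1 hi with rfl | hi
        · simp [hg₀]
        · have := hz i hi
          simp only [LinearMap.add_apply, LinearMap.smul_apply, smul_eq_mul, map_add,
            map_smul] at this ⊢
          linarith)
      simp only [LinearMap.add_apply, LinearMap.smul_apply, smul_eq_mul, map_add,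
        map_smul] at this ⊢
      linarith)
    refine ⟨fun i => if i = j then ∑ k ∈ s, y k * g k z₀ - f z₀ else y i, fun i => ?_, fun z => ?_⟩
    · dsimp only
      split_ifs
      · have := Finset.sum_nonneg fun k (hk : k ∈ s) => mul_nonneg (hy k) (hz₀ k hk)
        linarith
      · exact hy i
    · rw [Finset.sum_insert hj]
      have h1 := hf z
      simp only [LinearMap.add_apply, LinearMap.smul_apply, smul_eq_mul, mul_add,
        Finset.sum_add_distrib] at h1
      have h2 : ∑ i ∈ s, (if i = j then ∑ k ∈ s, y k * g k z₀ - f z₀ else y i) * g i z =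
          ∑ i ∈ s, y i * g i z :=
        Finset.sum_congr rfl fun i hi => by rw [if_neg (ne_of_mem_of_not_mem hi hj)]
      simp only [if_true]
      rw [h2]
      have h3 : ∑ i ∈ s, y i * (g i z₀ * g j z) = (∑ i ∈ s, y i * g i z₀) * g j z := by
        rw [Finset.sum_mul]; exact Finset.sum_congr rfl fun i _ => by ring
      rw [h3] at h1
      linarith

/-- Farkas' lemma on a subspace. -/
lemma farkas_submodule {ι V : Type*} [Fintype ι] [AddCommGroup V] [Module ℝ V]
    (W : Submodule ℝ V) (g : ι → V →ₗ[ℝ] ℝ) (f : V →ₗ[ℝ] ℝ)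
    (h : ∀ z ∈ W, (∀ i, 0 ≤ g i z) → 0 ≤ f z) :
    ∃ y : ι → ℝ, (∀ i, 0 ≤ y i) ∧ ∀ z ∈ W, f z = ∑ i, y i * g i z := by
  obtain ⟨y, hy, hf⟩ := farkas_finset Finset.univ (fun i => (g i).domRestrict W)
    (f.domRestrict W) (fun z hz => h z z.2 fun i => hz i (Finset.mem_univ _))
  exact ⟨y, hy, fun z hz => hf ⟨z, hz⟩⟩

variable {M}

lemma liq_le {t : ℕ} {ω : Ω} {S : ℝ} (hb : M.Sb t ω ≤ S) (ha : S ≤ M.Sa t ω) (γ δ : ℝ) :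
    liq M t ω γ δ ≤ γ + S * δ := by
  unfold liq
  rcases le_total 0 δ with h | h
  · rw [max_eq_left h, max_eq_right (by linarith)]
    nlinarith
  · rw [max_eq_right h, max_eq_left (by linarith)]
    nlinarith

lemma le_liq {t : ℕ} {ω : Ω} {γ δ c : ℝ} (hb : c ≤ γ + M.Sb t ω * δ) (ha : c ≤ γ + M.Sa t ω * δ) :
    c ≤ liq M t ω γ δ := by
  unfold liq
  rcases le_total 0 δ with h | h
  · rw [max_eq_left h, max_eq_right (by linarith)]
    linarith
  · rw [max_eq_right h, max_eq_left (by linarith)]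
    linarith

lemma liq_eq_add (t : ℕ) (ω : Ω) (γ δ : ℝ) : liq M t ω γ δ = γ + liq M t ω 0 δ := by
  unfold liq; ring

lemma liq_mul {t : ℕ} {ω : Ω} {c : ℝ} (hc : 0 ≤ c) (γ δ : ℝ) :
    liq M t ω (c * γ) (c * δ) = c * liq M t ω γ δ := by
  have h : ∀ x : ℝ, max (c * x) 0 = c * max x 0 := fun x => by
    rw [mul_max_of_nonneg _ _ hc, mul_zero]
  unfold liq
  rw [h, ← mul_neg, h]
  ring

lemma isAdapted_iff {X : ℕ → Ω → ℝ} :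
    IsAdapted M X ↔ ∀ t, t ≤ M.T → AtomConst (M.F t) (X t) := by
  simp only [IsAdapted, measurable_iff_atomConst]

lemma atomConst_Sb {t : ℕ} (ht : t ≤ M.T) : AtomConst (M.F t) (M.Sb t) :=
  (measurable_iff_atomConst _ _).1 (M.Sb_adapted t ht)

lemma atomConst_Sa {t : ℕ} (ht : t ≤ M.T) : AtomConst (M.F t) (M.Sa t) :=
  (measurable_iff_atomConst _ _).1 (M.Sa_adapted t ht)

lemma nonempty_of_market (M : Market Ω) : Nonempty Ω := by
  by_contra h
  rw [not_nonempty_iff] at h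
  have := M.Q_sum
  simp at this

lemma chiStar_eq_add {t : ℕ} (ht : t ≤ M.T) (χ : ℕ → Ω → ℝ) (ω : Ω) :
    chiStar M χ t ω = χ t ω + chiStar M χ (t + 1) ω := by
  rw [chiStar, chiStar, Finset.Icc_add_one_left_eq_Ioc, Finset.add_sum_Ioc_eq_sum_Icc (f := fun s => χ s ω) ht]

lemma starVal_eq_add {t : ℕ} (ht : t ≤ M.T) (χ S : ℕ → Ω → ℝ) (ω : Ω) :
    starVal M χ S t ω = χ t ω * S t ω + starVal M χ S (t + 1) ω := by
  rw [starVal, starVal, Finset.Icc_add_one_left_eq_Ioc,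
    Finset.add_sum_Ioc_eq_sum_Icc (f := fun s => χ s ω * S s ω) ht]

lemma chiStar_succ_last (χ : ℕ → Ω → ℝ) (ω : Ω) : chiStar M χ (M.T + 1) ω = 0 := by
  simp [chiStar]

lemma starVal_succ_last (χ S : ℕ → Ω → ℝ) (ω : Ω) : starVal M χ S (M.T + 1) ω = 0 := by
  simp [starVal]

lemma sum_range_add_chiStar {t : ℕ} (ht : t ≤ M.T + 1) (χ : ℕ → Ω → ℝ) (ω : Ω) :
    ∑ s ∈ Finset.range t, χ s ω + chiStar M χ t ω = ∑ s ∈ Finset.range (M.T + 1), χ s ω := by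
  rw [← Finset.sum_range_add_sum_Ico (fun s => χ s ω) ht, chiStar, Finset.Ico_add_one_right_eq_Icc]

namespace IsMixedStop

variable {χ : ℕ → Ω → ℝ}

lemma atomConst (hχ : IsMixedStop M χ) {t : ℕ} (ht : t ≤ M.T) : AtomConst (M.F t) (χ t) :=
  (measurable_iff_atomConst _ _).1 (hχ.1 t ht)

lemma chiStar_zero (hχ : IsMixedStop M χ) (ω : Ω) : chiStar M χ 0 ω = 1 := by
  have := sum_range_add_chiStar (M := M) (Nat.zero_le _) χ ω
  rw [hχ.2.2] at this
  simpa using this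

/-- `χ*` is predictable. -/
lemma atomConst_chiStar_succ (hχ : IsMixedStop M χ) {t : ℕ} (ht : t ≤ M.T) :
    AtomConst (M.F t) (chiStar M χ (t + 1)) := by
  have key : ∀ ω, chiStar M χ (t + 1) ω = 1 - ∑ s ∈ Finset.range (t + 1), χ s ω := fun ω => by
    rw [← hχ.2.2 ω, ← sum_range_add_chiStar (Nat.succ_le_succ ht) χ ω]
    ring
  intro ω ω' h
  rw [key, key]
  congr 1
  refine Finset.sum_congr rfl fun s hs => ?_
  have hst : s ≤ t := Nat.lt_succ_iff.1 (Finset.mem_range.1 hs)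
  exact hχ.atomConst (hst.trans ht) _ _ (h.mono (M.F_mono hst))

end IsMixedStop

/-- The conditional bounds in the definition of `memBarP`, tested against measurable functions. -/
def Consistent (M : Market Ω) (χ : ℕ → Ω → ℝ) (P : Ω → ℝ) (S : ℕ → Ω → ℝ) : Prop :=
  ∀ t, t ≤ M.T → ∀ δ : Ω → ℝ, AtomConst (M.F t) δ →
    ∑ ω, P ω * (chiStar M χ (t + 1) ω * liq M t ω 0 (δ ω)) ≤
      ∑ ω, P ω * (δ ω * starVal M χ S (t + 1) ω)

lemma memBarP.consistent {χ S : ℕ → Ω → ℝ} {P : Ω → ℝ} (h : memBarP M χ P S) :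
    Consistent M χ P S := by
  obtain ⟨hP, -, -, -, hc⟩ := h
  intro t ht δ hδ
  rw [← sum_mul_condExp (M.F t) hP _ hδ]
  refine Finset.sum_le_sum fun ω _ => ?_
  rcases (hP ω).eq_or_lt with h0 | hω
  · simp [← h0]
  refine mul_le_mul_of_nonneg_left ?_ (hP ω)
  obtain ⟨h1, h2⟩ := hc t ht ω hω
  unfold liq
  rcases le_total 0 (δ ω) with h | h
  · rw [max_eq_left h, max_eq_right (by linarith)]
    nlinarith
  · rw [max_eq_right h, max_eq_left (by linarith)]
    nlinarith

lemma Consistent.memBarP {χ S : ℕ → Ω → ℝ} {P : Ω → ℝ} (hχ : IsMixedStop M χ)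
    (hP : ∀ ω, 0 ≤ P ω) (hP1 : ∑ ω, P ω = 1) (hS : IsAdapted M S)
    (hSS : ∀ t ω, t ≤ M.T → M.Sb t ω ≤ S t ω ∧ S t ω ≤ M.Sa t ω) (hc : Consistent M χ P S) :
    memBarP M χ P S := by
  refine ⟨hP, hP1, hS, hSS, fun t ht ω hω => ?_⟩
  have hN := sum_mul_atomInd_pos (M.F t) hP hω
  have hI := atomConst_atomInd (M.F t) ω
  have hI0 := atomInd_nonneg (M.F t) ω
  have hχ' := hχ.atomConst_chiStar_succ ht
  rw [condExp_eq, le_div_iff₀ hN, div_le_iff₀ hN, Finset.mul_sum, Finset.mul_sum]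
  constructor
  · have h1 := hc t ht _ hI
    calc _ = ∑ ω', P ω' * (chiStar M χ (t + 1) ω' * liq M t ω' 0 (atomInd (M.F t) ω ω')) := by
          refine Finset.sum_congr rfl fun ω' _ => ?_
          unfold liq
          rw [max_eq_left (hI0 ω'), max_eq_right (by linarith [hI0 ω'])]
          linear_combination (-P ω' * chiStar M χ (t + 1) ω') * (atomConst_Sb ht).mul_atomInd ω ω' -
            P ω' * M.Sb t ω * hχ'.mul_atomInd ω ω'
      _ ≤ _ := h1
      _ = _ := Finset.sum_congr rfl fun ω' _ => by ring
  · have h1 := hc t ht (fun ω' => -atomInd (M.F t) ω ω') fun _ _ h => congrArg Neg.neg (hI _ _ h)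
    have h2 : ∑ ω', P ω' * (-atomInd (M.F t) ω ω' * starVal M χ S (t + 1) ω') =
        -∑ ω', P ω' * starVal M χ S (t + 1) ω' * atomInd (M.F t) ω ω' := by
      rw [← Finset.sum_neg_distrib]
      exact Finset.sum_congr rfl fun ω' _ => by ring
    have h3 : ∑ ω', P ω' * (chiStar M χ (t + 1) ω' * liq M t ω' 0 (-atomInd (M.F t) ω ω')) =
        -∑ ω', chiStar M χ (t + 1) ω * M.Sa t ω * (P ω' * atomInd (M.F t) ω ω') := by
      rw [← Finset.sum_neg_distrib]
      refine Finset.sum_congr rfl fun ω' _ => ?_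
      unfold liq
      rw [neg_neg, max_eq_left (hI0 ω'), max_eq_right (by linarith [hI0 ω'])]
      linear_combination (-P ω' * chiStar M χ (t + 1) ω') * (atomConst_Sa ht).mul_atomInd ω ω' -
            P ω' * M.Sa t ω * hχ'.mul_atomInd ω ω'
    linarith

lemma sum_mul_starVal (χ S : ℕ → Ω → ℝ) (P δ : Ω → ℝ) (t : ℕ) :
    ∑ ω, P ω * (δ ω * starVal M χ S t ω) =
      ∑ s ∈ Finset.Icc t M.T, ∑ ω, P ω * (δ ω * χ s ω * S s ω) := by
  rw [Finset.sum_comm]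
  refine Finset.sum_congr rfl fun ω _ => ?_
  rw [starVal, Finset.mul_sum, Finset.mul_sum]
  exact Finset.sum_congr rfl fun s _ => by ring

lemma expect_mixVal (χ ξ ζ S : ℕ → Ω → ℝ) (P : Ω → ℝ) :
    expect P (mixVal M χ fun t ω => ξ t ω + S t ω * ζ t ω) =
      ∑ s ∈ Finset.range (M.T + 1),
        (∑ ω, P ω * (ξ s ω * χ s ω) + ∑ ω, P ω * (ζ s ω * χ s ω * S s ω)) := by
  simp only [← Finset.sum_add_distrib]
  rw [Finset.sum_comm, expect]
  refine Finset.sum_congr rfl fun ω _ => ?_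
  rw [mixVal, Finset.mul_sum]
  exact Finset.sum_congr rfl fun s _ => by ring

/-- A martingale between the bid and ask prices is consistent with every mixed stopping time. -/
lemma exists_memP_of_arbitrageFree (hNA : ArbitrageFree M) :
    ∃ (P : Ω → ℝ) (S : ℕ → Ω → ℝ), ∀ χ, IsMixedStop M χ → memP M χ P S := by
  obtain ⟨P, S, hP, hP1, hS, hSS, hmart⟩ := hNA
  have hP0 : ∀ ω, 0 ≤ P ω := fun ω => (hP ω).le
  refine ⟨P, S, fun χ hχ => ⟨Consistent.memBarP hχ hP0 hP1 hS hSS ?_, hP⟩⟩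
  have hmart' : ∀ t, t < M.T → ∀ φ, AtomConst (M.F t) φ →
      ∑ ω, P ω * (φ ω * S (t + 1) ω) = ∑ ω, P ω * (φ ω * S t ω) := fun t ht φ hφ => by
    rw [← sum_mul_condExp (M.F t) hP0 _ hφ]
    exact Finset.sum_congr rfl fun ω _ => by rw [hmart t ht ω (hP ω)]
  have key : ∀ t, t ≤ M.T → ∀ φ, AtomConst (M.F t) φ →
      ∑ ω, P ω * (φ ω * starVal M χ S (t + 1) ω) =
        ∑ ω, P ω * (φ ω * (chiStar M χ (t + 1) ω * S t ω)) := by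
    intro t ht
    induction ht using Nat.decreasingInduction with
    | self => intro φ _; simp [starVal_succ_last, chiStar_succ_last]
    | of_succ t ht ih =>
      intro φ hφ
      have h1 := ih φ (hφ.mono (M.F_mono t.le_succ))
      have h2 := hmart' t ht (fun ω => φ ω * chiStar M χ (t + 1) ω) fun ω ω' h => by
        dsimp only
        rw [hφ _ _ h, hχ.atomConst_chiStar_succ ht.le _ _ h]
      calc _ = ∑ ω, P ω * (φ ω * (χ (t + 1) ω * S (t + 1) ω)) +
            ∑ ω, P ω * (φ ω * starVal M χ S (t + 1 + 1) ω) := by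
            rw [← Finset.sum_add_distrib]
            exact Finset.sum_congr rfl fun ω _ => by rw [starVal_eq_add ht]; ring
        _ = ∑ ω, P ω * (φ ω * chiStar M χ (t + 1) ω * S (t + 1) ω) := by
            rw [h1, ← Finset.sum_add_distrib]
            exact Finset.sum_congr rfl fun ω _ => by rw [chiStar_eq_add ht]; ring
        _ = _ := by
            rw [h2]
            exact Finset.sum_congr rfl fun ω _ => by ring
  intro t ht δ hδ
  rw [key t ht δ hδ]
  refine Finset.sum_le_sum fun ω _ => mul_le_mul_of_nonneg_left ?_ (hP0 ω)
  have h1 := liq_le (hSS t ω ht).1 (hSS t ω ht).2 0 (δ ω)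
  have h2 : 0 ≤ chiStar M χ (t + 1) ω := Finset.sum_nonneg fun s _ => hχ.2.1 s ω
  nlinarith [mul_le_mul_of_nonneg_left h1 h2]

lemma isStop_const {t : ℕ} (ht : t ≤ M.T) : IsStop M fun _ => t :=
  ⟨fun _ => ht, fun _ => MeasurableSet.const _⟩

lemma SellerHedge.atomConst {ξ ζ α β : ℕ → Ω → ℝ} (h : SellerHedge M ξ ζ α β) {t : ℕ}
    (ht : t ≤ M.T) : AtomConst (M.F (t - 1)) (α t) ∧ AtomConst (M.F (t - 1)) (β t) := by
  obtain ⟨⟨h1, h2, h3, -⟩, -⟩ := h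
  simp only [measurable_iff_atomConst] at h1 h2 h3
  cases t with
  | zero => exact ⟨h1, h2⟩
  | succ t => exact h3 t ht

lemma liq_zero_eq (ω ω' : Ω) (γ δ : ℝ) : liq M 0 ω γ δ = liq M 0 ω' γ δ := by
  have h1 := atomConst_Sb (M := M) (Nat.zero_le _)
  have h2 := atomConst_Sa (M := M) (Nat.zero_le _)
  rw [M.F_zero] at h1 h2
  rw [liq, liq, h1.eq_of_bot ω ω', h2.eq_of_bot ω ω']

lemma SellerHedge.initial_eq {ξ ζ α β : ℕ → Ω → ℝ} (h : SellerHedge M ξ ζ α β) (ω ω' : Ω) :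
    α 0 ω = α 0 ω' ∧ β 0 ω = β 0 ω' := by
  obtain ⟨h1, h2⟩ := h.atomConst (Nat.zero_le _)
  rw [Nat.zero_sub, M.F_zero] at h1 h2
  exact ⟨h1.eq_of_bot ω ω', h2.eq_of_bot ω ω'⟩

lemma SellerHedge.cost_eq {ξ ζ α β : ℕ → Ω → ℝ} (h : SellerHedge M ξ ζ α β) (ω ω' : Ω) :
    -liq M 0 ω (-α 0 ω) (-β 0 ω) = -liq M 0 ω' (-α 0 ω') (-β 0 ω') := by
  rw [(h.initial_eq ω ω').1, (h.initial_eq ω ω').2, liq_zero_eq ω ω']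

/-- Weak duality: superhedging costs dominate the expected discounted payoffs. -/
lemma expect_le_cost {ξ ζ α β χ S : ℕ → Ω → ℝ} {P : Ω → ℝ} (h : SellerHedge M ξ ζ α β)
    (hχ : IsMixedStop M χ) (hPS : memBarP M χ P S) (ω₀ : Ω) :
    expect P (mixVal M χ fun t ω => ξ t ω + S t ω * ζ t ω) ≤
      -liq M 0 ω₀ (-α 0 ω₀) (-β 0 ω₀) := by
  have hadp : ∀ t, t ≤ M.T → AtomConst (M.F t) (α t) ∧ AtomConst (M.F t) (β t) := fun t ht =>
    ⟨(h.atomConst ht).1.mono (M.F_mono (Nat.sub_le _ _)),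
      (h.atomConst ht).2.mono (M.F_mono (Nat.sub_le _ _))⟩
  have hc := hPS.consistent
  obtain ⟨hP, hP1, -, hSS, -⟩ := hPS
  have hstep : ∀ t, t ≤ M.T →
      ∑ s ∈ Finset.Icc t M.T, ∑ ω, P ω * (χ s ω * (α s ω + S s ω * β s ω)) ≤
        ∑ ω, P ω * (chiStar M χ t ω * α t ω + starVal M χ S t ω * β t ω) := by
    intro t ht
    induction ht using Nat.decreasingInduction with
    | self =>
      rw [Finset.Icc_self, Finset.sum_singleton]
      refine (Finset.sum_congr rfl fun ω _ => ?_).le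
      rw [chiStar_eq_add le_rfl, starVal_eq_add le_rfl, chiStar_succ_last, starVal_succ_last]
      ring
    | of_succ t ht ih =>
      have h1 := hc t ht.le (fun ω => β t ω - β (t + 1) ω) fun ω ω' hω => by
        dsimp only
        rw [(hadp t ht.le).2 _ _ hω, (h.atomConst ht).2 _ _ hω]
      have h2 : 0 ≤ ∑ ω, P ω * (chiStar M χ (t + 1) ω * (α t ω - α (t + 1) ω)) +
          ∑ ω, P ω * (chiStar M χ (t + 1) ω * liq M t ω 0 (β t ω - β (t + 1) ω)) := by
        rw [← Finset.sum_add_distrib]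
        refine Finset.sum_nonneg fun ω _ => ?_
        have h3 := h.1.2.2.2 t ht ω
        rw [liq_eq_add] at h3
        have h4 : 0 ≤ chiStar M χ (t + 1) ω := Finset.sum_nonneg fun s _ => hχ.2.1 s ω
        rw [← mul_add, ← mul_add]
        exact mul_nonneg (hP ω) (mul_nonneg h4 h3)
      rw [← Finset.add_sum_Ioc_eq_sum_Icc ht.le, ← Finset.Icc_add_one_left_eq_Ioc]
      have h5 : ∑ ω, P ω * (chiStar M χ t ω * α t ω + starVal M χ S t ω * β t ω) =
          ∑ ω, P ω * (χ t ω * (α t ω + S t ω * β t ω)) +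
          ∑ ω, P ω * (chiStar M χ (t + 1) ω * α (t + 1) ω +
            starVal M χ S (t + 1) ω * β (t + 1) ω) +
          (∑ ω, P ω * (chiStar M χ (t + 1) ω * (α t ω - α (t + 1) ω)) +
          ∑ ω, P ω * ((β t ω - β (t + 1) ω) * starVal M χ S (t + 1) ω)) := by
        simp only [← Finset.sum_add_distrib]
        refine Finset.sum_congr rfl fun ω _ => ?_
        rw [chiStar_eq_add ht.le, starVal_eq_add ht.le]
        ring
      linarith
  have hα : ∀ ω, α 0 ω = α 0 ω₀ := fun ω => (h.initial_eq ω ω₀).1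
  have hβ : ∀ ω, β 0 ω = β 0 ω₀ := fun ω => (h.initial_eq ω ω₀).2
  have hliq : ∀ ω y, liq M 0 ω 0 y = liq M 0 ω₀ 0 y := fun ω y => liq_zero_eq ω ω₀ 0 y
  calc _ = ∑ s ∈ Finset.range (M.T + 1), ∑ ω, P ω * (χ s ω * (ξ s ω + S s ω * ζ s ω)) := by
        rw [expect_mixVal]
        refine Finset.sum_congr rfl fun s _ => ?_
        rw [← Finset.sum_add_distrib]
        exact Finset.sum_congr rfl fun ω _ => by ring
    _ ≤ ∑ s ∈ Finset.range (M.T + 1), ∑ ω, P ω * (χ s ω * (α s ω + S s ω * β s ω)) := by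
        refine Finset.sum_le_sum fun s hs => Finset.sum_le_sum fun ω _ =>
          mul_le_mul_of_nonneg_left (mul_le_mul_of_nonneg_left ?_ (hχ.2.1 s ω)) (hP ω)
        have hs' : s ≤ M.T := Nat.lt_succ_iff.1 (Finset.mem_range.1 hs)
        have h1 := h.2 _ (isStop_const hs') ω
        have h2 := liq_le (hSS s ω hs').1 (hSS s ω hs').2 (α s ω - ξ s ω) (β s ω - ζ s ω)
        linarith
    _ = ∑ s ∈ Finset.Icc 0 M.T, ∑ ω, P ω * (χ s ω * (α s ω + S s ω * β s ω)) := by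
        rw [Finset.range_eq_Ico, Finset.Ico_add_one_right_eq_Icc]
    _ ≤ ∑ ω, P ω * (chiStar M χ 0 ω * α 0 ω + starVal M χ S 0 ω * β 0 ω) :=
        hstep 0 (Nat.zero_le _)
    _ ≤ ∑ ω, P ω * (α 0 ω₀ - liq M 0 ω₀ 0 (-β 0 ω₀)) := by
        have h1 := hc 0 (Nat.zero_le _) (fun _ => -β 0 ω₀) fun _ _ _ => rfl
        have h2 : ∑ ω, P ω * (χ 0 ω * liq M 0 ω 0 (-β 0 ω₀)) ≤
            ∑ ω, P ω * (χ 0 ω * (S 0 ω * -β 0 ω₀)) := by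
          refine Finset.sum_le_sum fun ω _ =>
            mul_le_mul_of_nonneg_left (mul_le_mul_of_nonneg_left ?_ (hχ.2.1 0 ω)) (hP ω)
          have := liq_le (hSS 0 ω (Nat.zero_le _)).1 (hSS 0 ω (Nat.zero_le _)).2 0 (-β 0 ω₀)
          linarith
        have h3 : ∑ ω, P ω * (α 0 ω₀ - liq M 0 ω₀ 0 (-β 0 ω₀)) -
            ∑ ω, P ω * (chiStar M χ 0 ω * α 0 ω + starVal M χ S 0 ω * β 0 ω) =
            (∑ ω, P ω * (-β 0 ω₀ * starVal M χ S (0 + 1) ω) -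
              ∑ ω, P ω * (chiStar M χ (0 + 1) ω * liq M 0 ω 0 (-β 0 ω₀))) +
            (∑ ω, P ω * (χ 0 ω * (S 0 ω * -β 0 ω₀)) -
              ∑ ω, P ω * (χ 0 ω * liq M 0 ω 0 (-β 0 ω₀))) := by
          simp only [← Finset.sum_sub_distrib, ← Finset.sum_add_distrib]
          refine Finset.sum_congr rfl fun ω _ => ?_
          have h4 := hχ.chiStar_zero ω
          have h5 := chiStar_eq_add (M := M) (Nat.zero_le _) χ ω
          rw [h4] at h5
          rw [h4, starVal_eq_add (Nat.zero_le _), hliq ω, hα ω, hβ ω]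
          linear_combination (-P ω * liq M 0 ω₀ 0 (-β 0 ω₀)) * h5
        linarith
    _ = _ := by
        rw [← Finset.sum_mul, hP1, liq_eq_add 0 ω₀ (-α 0 ω₀)]
        ring

/-- For a fixed mixed stopping time, pairs can be mixed, and the expected payoff is affine. -/
lemma exists_mix {χ : ℕ → Ω → ℝ} (hχ : IsMixedStop M χ) {P P' : Ω → ℝ} {S S' : ℕ → Ω → ℝ}
    (h : memBarP M χ P S) (h' : memP M χ P' S') {ξ ζ : ℕ → Ω → ℝ} (hpay : AdaptedPair M ξ ζ)
    {ε : ℝ} (hε : 0 < ε) (hε1 : ε ≤ 1) :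
    ∃ P'' S'', memP M χ P'' S'' ∧
      expect P'' (mixVal M χ fun t ω => ξ t ω + S'' t ω * ζ t ω) =
        (1 - ε) * expect P (mixVal M χ fun t ω => ξ t ω + S t ω * ζ t ω) +
          ε * expect P' (mixVal M χ fun t ω => ξ t ω + S' t ω * ζ t ω) := by
  have hc := h.consistent
  have hc' := h'.1.consistent
  obtain ⟨hP, hP1, hS, hSS, -⟩ := h
  obtain ⟨⟨-, hP1', hS', hSS', -⟩, hP'⟩ := h'
  have hε0 : 0 ≤ 1 - ε := by linarith
  set R : Ω → ℝ := fun ω => (1 - ε) * P ω + ε * P' ω with hR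
  have hRpos : ∀ ω, 0 < R ω := fun ω =>
    add_pos_of_nonneg_of_pos (mul_nonneg hε0 (hP ω)) (mul_pos hε (hP' ω))
  have hR0 : ∀ ω, 0 ≤ R ω := fun ω => (hRpos ω).le
  have hRsum : ∀ f : Ω → ℝ,
      ∑ ω, R ω * f ω = (1 - ε) * ∑ ω, P ω * f ω + ε * ∑ ω, P' ω * f ω := fun f => by
    rw [Finset.mul_sum, Finset.mul_sum, ← Finset.sum_add_distrib]
    exact Finset.sum_congr rfl fun ω _ => by simp only [hR]; ring
  set U : ℕ → Ω → ℝ := fun t ω => ((1 - ε) * P ω * S t ω + ε * P' ω * S' t ω) / R ω with hU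
  set S'' : ℕ → Ω → ℝ := fun t => condExp (M.F t) R (U t) with hS''
  have hlin : ∀ t, ∀ φ, AtomConst (M.F t) φ → ∑ ω, R ω * (φ ω * S'' t ω) =
      (1 - ε) * ∑ ω, P ω * (φ ω * S t ω) + ε * ∑ ω, P' ω * (φ ω * S' t ω) := by
    intro t φ hφ
    rw [hS'', sum_mul_condExp (M.F t) hR0 _ hφ, Finset.mul_sum, Finset.mul_sum,
      ← Finset.sum_add_distrib]
    refine Finset.sum_congr rfl fun ω _ => ?_
    have := (hRpos ω).ne'
    simp only [hU]
    field_simp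
  refine ⟨R, S'', ⟨Consistent.memBarP hχ hR0 ?_ ?_ ?_ ?_, hRpos⟩, ?_⟩
  · have := hRsum 1
    simp only [Pi.one_apply, mul_one, hP1, hP1'] at this
    linarith
  · exact isAdapted_iff.2 fun t _ => atomConst_condExp _ _ _
  · intro t ω ht
    constructor
    · refine le_condExp hR0 (atomConst_Sb ht) (fun ω => ?_) (hRpos ω)
      rw [hU, le_div_iff₀ (hRpos ω), hR]
      have h1 := mul_le_mul_of_nonneg_left (hSS t ω ht).1 (mul_nonneg hε0 (hP ω))
      have h2 := mul_le_mul_of_nonneg_left (hSS' t ω ht).1 (mul_nonneg hε.le (hP' ω).le)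
      linarith
    · refine condExp_le hR0 (atomConst_Sa ht) (fun ω => ?_) (hRpos ω)
      rw [hU, div_le_iff₀ (hRpos ω), hR]
      have h1 := mul_le_mul_of_nonneg_left (hSS t ω ht).2 (mul_nonneg hε0 (hP ω))
      have h2 := mul_le_mul_of_nonneg_left (hSS' t ω ht).2 (mul_nonneg hε.le (hP' ω).le)
      linarith
  · intro t ht δ hδ
    have h1 : ∑ ω, R ω * (δ ω * starVal M χ S'' (t + 1) ω) =
        (1 - ε) * ∑ ω, P ω * (δ ω * starVal M χ S (t + 1) ω) +
          ε * ∑ ω, P' ω * (δ ω * starVal M χ S' (t + 1) ω) := by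
      rw [sum_mul_starVal, sum_mul_starVal, sum_mul_starVal, Finset.mul_sum, Finset.mul_sum,
        ← Finset.sum_add_distrib]
      refine Finset.sum_congr rfl fun s hs => hlin s (fun ω => δ ω * χ s ω) fun ω ω' hω => ?_
      obtain ⟨hs1, hs2⟩ := Finset.mem_Icc.1 hs
      dsimp only
      rw [hδ _ _ (hω.mono (M.F_mono (by omega))), hχ.atomConst hs2 _ _ hω]
    rw [h1, hRsum]
    exact add_le_add (mul_le_mul_of_nonneg_left (hc t ht δ hδ) hε0)
      (mul_le_mul_of_nonneg_left (hc' t ht δ hδ) hε.le)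
  · rw [expect_mixVal, expect_mixVal, expect_mixVal, Finset.mul_sum, Finset.mul_sum,
      ← Finset.sum_add_distrib]
    refine Finset.sum_congr rfl fun s hs => ?_
    have hs' : s ≤ M.T := Nat.lt_succ_iff.1 (Finset.mem_range.1 hs)
    have h1 := hlin s (fun ω => ζ s ω * χ s ω) fun ω ω' hω => by
      dsimp only
      rw [isAdapted_iff.1 hpay.2 s hs' _ _ hω, hχ.atomConst hs' _ _ hω]
    rw [hRsum, h1]
    ring

/-- A nonnegative mass flow: at each time the mass carried by the nodes is split into an exercised
part `m` (of value `n`) and a continuing part `k` (of value `l`). -/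
structure IsFlow (M : Market Ω) (m n k l : ℕ → Ω → ℝ) : Prop where
  adapted : ∀ t, t ≤ M.T → AtomConst (M.F t) (m t) ∧ AtomConst (M.F t) (n t) ∧
    AtomConst (M.F t) (k t) ∧ AtomConst (M.F t) (l t)
  nonneg : ∀ t ω, 0 ≤ m t ω ∧ 0 ≤ k t ω
  exercise_bounds : ∀ t ω, t ≤ M.T → M.Sb t ω * m t ω ≤ n t ω ∧ n t ω ≤ M.Sa t ω * m t ω
  continue_bounds : ∀ t ω, t ≤ M.T → M.Sb t ω * k t ω ≤ l t ω ∧ l t ω ≤ M.Sa t ω * k t ω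
  initial : ∑ ω, (m 0 ω + k 0 ω) = 1
  mass : ∀ t, t < M.T → ∀ φ, AtomConst (M.F t) φ →
    ∑ ω, φ ω * (m (t + 1) ω + k (t + 1) ω) = ∑ ω, φ ω * k t ω
  value : ∀ t, t < M.T → ∀ φ, AtomConst (M.F t) φ →
    ∑ ω, φ ω * (n (t + 1) ω + l (t + 1) ω) = ∑ ω, φ ω * l t ω
  final : ∀ ω, k M.T ω = 0

namespace IsFlow

variable {m n k l : ℕ → Ω → ℝ}

/-- The conditional probability of exercising at time `t`. -/
def hazard (m k : ℕ → Ω → ℝ) (t : ℕ) (ω : Ω) : ℝ :=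
  if m t ω + k t ω = 0 then 1 else m t ω / (m t ω + k t ω)

/-- The conditional probability of not having exercised before time `t`. -/
def survival (m k : ℕ → Ω → ℝ) (t : ℕ) (ω : Ω) : ℝ := ∏ s ∈ Finset.range t, (1 - hazard m k s ω)

/-- The density of the measure carrying the flow, restricted to the time-`t` σ-field. -/
def density (m k : ℕ → Ω → ℝ) (t : ℕ) (ω : Ω) : ℝ :=
  (Fintype.card Ω : ℝ)⁻¹ *
    ∏ s ∈ Finset.range t, if k s ω = 0 then 1 else (m (s + 1) ω + k (s + 1) ω) / k s ω

lemma density_succ (m k : ℕ → Ω → ℝ) (t : ℕ) (ω : Ω) : density m k (t + 1) ω =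
    density m k t ω * if k t ω = 0 then 1 else (m (t + 1) ω + k (t + 1) ω) / k t ω := by
  rw [density, density, Finset.prod_range_succ, mul_assoc]

lemma survival_succ (m k : ℕ → Ω → ℝ) (t : ℕ) (ω : Ω) :
    survival m k (t + 1) ω = survival m k t ω * (1 - hazard m k t ω) :=
  Finset.prod_range_succ _ _

lemma hazard_nonneg (h : IsFlow M m n k l) (t : ℕ) (ω : Ω) : 0 ≤ hazard m k t ω := by
  have := h.nonneg t ω
  unfold hazard
  split_ifs
  · exact zero_le_one
  · exact div_nonneg this.1 (add_nonneg this.1 this.2)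

lemma hazard_mul (h : IsFlow M m n k l) (t : ℕ) (ω : Ω) :
    hazard m k t ω * (m t ω + k t ω) = m t ω := by
  have := h.nonneg t ω
  unfold hazard
  split_ifs with h0
  · linarith
  · exact div_mul_cancel₀ _ h0

lemma hazard_le_one (h : IsFlow M m n k l) (t : ℕ) (ω : Ω) : hazard m k t ω ≤ 1 := by
  have := h.nonneg t ω
  unfold hazard
  split_ifs
  · exact le_rfl
  · exact div_le_one_of_le₀ (by linarith) (by linarith)

lemma survival_nonneg (h : IsFlow M m n k l) (t : ℕ) (ω : Ω) : 0 ≤ survival m k t ω :=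
  Finset.prod_nonneg fun s _ => sub_nonneg.2 (h.hazard_le_one s ω)

lemma density_nonneg (h : IsFlow M m n k l) (t : ℕ) (ω : Ω) : 0 ≤ density m k t ω := by
  refine mul_nonneg (inv_nonneg.2 (Nat.cast_nonneg _)) (Finset.prod_nonneg fun s _ => ?_)
  split_ifs
  · exact zero_le_one
  · exact div_nonneg (add_nonneg (h.nonneg _ ω).1 (h.nonneg _ ω).2) (h.nonneg s ω).2

lemma eq_of_sameAtom (h : IsFlow M m n k l) {s t : ℕ} (hst : s ≤ t) (ht : t ≤ M.T) {ω ω' : Ω}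
    (hω : sameAtom (M.F t) ω ω') : m s ω = m s ω' ∧ k s ω = k s ω' :=
  have hs := h.adapted s (hst.trans ht)
  ⟨hs.1 _ _ (hω.mono (M.F_mono hst)), hs.2.2.1 _ _ (hω.mono (M.F_mono hst))⟩

lemma hazard_eq_of_sameAtom (h : IsFlow M m n k l) {s t : ℕ} (hst : s ≤ t) (ht : t ≤ M.T)
    {ω ω' : Ω} (hω : sameAtom (M.F t) ω ω') : hazard m k s ω = hazard m k s ω' := by
  obtain ⟨h1, h2⟩ := h.eq_of_sameAtom hst ht hω
  rw [hazard, hazard, h1, h2]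

lemma atomConst_survival (h : IsFlow M m n k l) {t : ℕ} (ht : t ≤ M.T) :
    AtomConst (M.F t) (survival m k t) := fun _ _ hω => Finset.prod_congr rfl fun s hs => by
  rw [h.hazard_eq_of_sameAtom (Finset.mem_range.1 hs).le ht hω]

lemma atomConst_density (h : IsFlow M m n k l) {t : ℕ} (ht : t ≤ M.T) :
    AtomConst (M.F t) (density m k t) := fun _ _ hω => by
  refine congrArg (_ * ·) (Finset.prod_congr rfl fun s hs => ?_)
  obtain ⟨h1, h2⟩ := h.eq_of_sameAtom (Finset.mem_range.1 hs).le ht hω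
  obtain ⟨h3, h4⟩ := h.eq_of_sameAtom (Finset.mem_range.1 hs) ht hω
  rw [h2, h3, h4]

lemma hazard_last (h : IsFlow M m n k l) (ω : Ω) : hazard m k M.T ω = 1 := by
  unfold hazard
  rw [h.final, add_zero]
  split_ifs with h0
  · rfl
  · exact div_self h0

lemma sum_density_succ (h : IsFlow M m n k l) {t : ℕ} (ht : t < M.T) {φ : Ω → ℝ}
    (hφ : AtomConst (M.F t) φ) :
    ∑ ω, φ ω * density m k (t + 1) ω = ∑ ω, φ ω * density m k t ω := by
  set c : Ω → ℝ := fun ω => φ ω * density m k t ω with hc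
  have hcc : AtomConst (M.F t) c := fun ω ω' hω => by
    simp only [hc, hφ _ _ hω, h.atomConst_density ht.le _ _ hω]
  have h1 := h.mass t ht (fun ω => c ω * (k t ω)⁻¹) fun ω ω' hω => by
    simp only [hcc _ _ hω, (h.eq_of_sameAtom le_rfl ht.le hω).2]
  have h2 : ∀ ω, φ ω * density m k (t + 1) ω - φ ω * density m k t ω =
      c ω * (k t ω)⁻¹ * (m (t + 1) ω + k (t + 1) ω) - c ω * (k t ω)⁻¹ * k t ω := by
    intro ω
    rw [density_succ]
    simp only [hc]
    split_ifs with h0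
    · simp [h0]
    · field_simp
  rw [← sub_eq_zero, ← Finset.sum_sub_distrib, Finset.sum_congr rfl fun ω _ => h2 ω,
    Finset.sum_sub_distrib, h1, sub_self]

lemma sum_density_last (h : IsFlow M m n k l) {t : ℕ} (ht : t ≤ M.T) {φ : Ω → ℝ}
    (hφ : AtomConst (M.F t) φ) :
    ∑ ω, φ ω * density m k M.T ω = ∑ ω, φ ω * density m k t ω := by
  induction ht using Nat.decreasingInduction with
  | self => rfl
  | of_succ t ht ih => rw [ih (hφ.mono (M.F_mono t.le_succ)), h.sum_density_succ ht hφ]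

lemma survival_succ_mul {t : ℕ} (h : IsFlow M m n k l) {ω : Ω}
    (h0 : survival m k t ω * density m k t ω = m t ω + k t ω) :
    survival m k (t + 1) ω * density m k t ω = k t ω := by
  rw [survival_succ]
  linear_combination (1 - hazard m k t ω) * h0 - h.hazard_mul t ω

/-- The surviving mass is the mass of the flow. -/
lemma survival_mul_density (h : IsFlow M m n k l) {t : ℕ} (ht : t ≤ M.T) (ω : Ω) :
    survival m k t ω * density m k t ω = m t ω + k t ω := by
  induction t with
  | zero =>
    have hconst : ∀ ω', m 0 ω' + k 0 ω' = m 0 ω + k 0 ω := fun ω' => by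
      have h1 := (h.adapted 0 ht).1
      have h2 := (h.adapted 0 ht).2.2.1
      rw [M.F_zero] at h1 h2
      rw [h1.eq_of_bot ω' ω, h2.eq_of_bot ω' ω]
    have h1 := h.initial
    rw [Finset.sum_congr rfl fun ω' _ => hconst ω', Finset.sum_const, Finset.card_univ,
      nsmul_eq_mul] at h1
    have : (Fintype.card Ω : ℝ) ≠ 0 := left_ne_zero_of_mul_eq_one h1
    simp only [survival, density, Finset.range_zero, Finset.prod_empty, one_mul, mul_one]
    field_simp
    linarith
  | succ t ih =>
    have h1 := h.survival_succ_mul (ih (by omega))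
    rw [density_succ, ← mul_assoc, h1]
    split_ifs with h0
    · have hnn : ∀ ω' ∈ Finset.univ,
          0 ≤ atomInd (M.F t) ω ω' * (m (t + 1) ω' + k (t + 1) ω') := fun ω' _ =>
        mul_nonneg (atomInd_nonneg _ _ _) (add_nonneg (h.nonneg _ _).1 (h.nonneg _ _).2)
      have h2 := h.mass t ht _ (atomConst_atomInd (M.F t) ω)
      have h3 : ∑ ω', atomInd (M.F t) ω ω' * k t ω' = 0 := Finset.sum_eq_zero fun ω' _ => by
        rw [mul_comm, (h.adapted t (by omega)).2.2.1.mul_atomInd, h0, zero_mul]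
      rw [h3, Finset.sum_eq_zero_iff_of_nonneg hnn] at h2
      have h4 := h2 ω (Finset.mem_univ _)
      rw [atomInd_self, one_mul] at h4
      rw [h4, h0, zero_mul]
    · field_simp

/-- Every flow is generated by a mixed stopping time and a pricing pair. -/
lemma exists_pair (h : IsFlow M m n k l) {ξ ζ : ℕ → Ω → ℝ} (hpay : AdaptedPair M ξ ζ) :
    ∃ χ P S, IsMixedStop M χ ∧ memBarP M χ P S ∧
      expect P (mixVal M χ fun t ω => ξ t ω + S t ω * ζ t ω) =
        ∑ t ∈ Finset.range (M.T + 1), ∑ ω, (ξ t ω * m t ω + ζ t ω * n t ω) := by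
  set P := density m k M.T with hPdef
  set χ : ℕ → Ω → ℝ := fun t ω => survival m k t ω * hazard m k t ω with hχdef
  set S : ℕ → Ω → ℝ := fun t ω => if m t ω = 0 then M.Sb t ω else n t ω / m t ω with hSdef
  have hP0 : ∀ ω, 0 ≤ P ω := h.density_nonneg _
  have hpart : ∀ t ω, ∑ s ∈ Finset.range t, χ s ω = 1 - survival m k t ω := by
    intro t ω
    induction t with
    | zero => simp [survival]
    | succ t ih =>
      rw [Finset.sum_range_succ, ih, survival_succ]
      simp only [hχdef]
      ring
  have hlast : ∀ ω, survival m k (M.T + 1) ω = 0 := fun ω => by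
    rw [survival_succ, h.hazard_last, sub_self, mul_zero]
  have hχ1 : ∀ ω, ∑ t ∈ Finset.range (M.T + 1), χ t ω = 1 := fun ω => by
    rw [hpart, hlast, sub_zero]
  have hχ : IsMixedStop M χ := by
    refine ⟨fun t ht => (measurable_iff_atomConst _ _).2 fun ω ω' hω => ?_, fun t ω => ?_, hχ1⟩
    · simp only [hχdef, h.atomConst_survival ht _ _ hω, h.hazard_eq_of_sameAtom le_rfl ht hω]
    · exact mul_nonneg (h.survival_nonneg t ω) (h.hazard_nonneg t ω)
  have hstar : ∀ t, t ≤ M.T → ∀ ω, chiStar M χ (t + 1) ω = survival m k (t + 1) ω := by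
    intro t ht ω
    have := sum_range_add_chiStar (Nat.succ_le_succ ht) χ ω
    rw [hχ1, Nat.succ_eq_add_one, hpart] at this
    linarith
  have hSm : ∀ t, t ≤ M.T → ∀ ω, m t ω * S t ω = n t ω := by
    intro t ht ω
    simp only [hSdef]
    split_ifs with h0
    · have := h.exercise_bounds t ω ht
      rw [h0, mul_zero, mul_zero] at this
      rw [h0, zero_mul]
      linarith
    · field_simp
  have hSadp : IsAdapted M S := isAdapted_iff.2 fun t ht ω ω' hω => by
    simp only [hSdef, (h.adapted t ht).1 _ _ hω, (h.adapted t ht).2.1 _ _ hω,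
      atomConst_Sb ht _ _ hω]
  have hm : ∀ t, t ≤ M.T → ∀ φ, AtomConst (M.F t) φ →
      ∑ ω, P ω * (φ ω * χ t ω) = ∑ ω, φ ω * m t ω := by
    intro t ht φ hφ
    have h1 := h.sum_density_last ht (φ := fun ω => φ ω * χ t ω) fun ω ω' hω => by
      simp only [hφ _ _ hω, hχ.atomConst ht _ _ hω]
    calc _ = ∑ ω, φ ω * χ t ω * density m k M.T ω :=
          Finset.sum_congr rfl fun ω _ => mul_comm _ _
      _ = _ := h1
      _ = _ := Finset.sum_congr rfl fun ω _ => by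
        simp only [hχdef]
        linear_combination φ ω * hazard m k t ω * h.survival_mul_density ht ω +
          φ ω * h.hazard_mul t ω
  have hn : ∀ t, t ≤ M.T → ∀ φ, AtomConst (M.F t) φ →
      ∑ ω, P ω * (φ ω * χ t ω * S t ω) = ∑ ω, φ ω * n t ω := by
    intro t ht φ hφ
    have h1 := hm t ht (fun ω => φ ω * S t ω) fun ω ω' hω => by
      simp only [hφ _ _ hω, isAdapted_iff.1 hSadp t ht _ _ hω]
    calc _ = ∑ ω, P ω * (φ ω * S t ω * χ t ω) := Finset.sum_congr rfl fun ω _ => by ring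
      _ = _ := h1
      _ = _ := Finset.sum_congr rfl fun ω _ => by rw [← hSm t ht ω]; ring
  have hl : ∀ t, t ≤ M.T → ∀ φ, AtomConst (M.F t) φ →
      ∑ ω, φ ω * l t ω = ∑ s ∈ Finset.Icc (t + 1) M.T, ∑ ω, φ ω * n s ω := by
    intro t ht
    induction ht using Nat.decreasingInduction with
    | self =>
      intro φ _
      have : ∀ ω, l M.T ω = 0 := fun ω => by
        have := h.continue_bounds M.T ω le_rfl
        rw [h.final, mul_zero, mul_zero] at this
        linarith
      simp [this]
    | of_succ t ht ih =>
      intro φ hφ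
      rw [← h.value t ht φ hφ, ← Finset.add_sum_Ioc_eq_sum_Icc (a := t + 1) ht,
        ← Finset.Icc_add_one_left_eq_Ioc, ← ih φ (hφ.mono (M.F_mono t.le_succ)),
        ← Finset.sum_add_distrib]
      exact Finset.sum_congr rfl fun ω _ => by ring
  refine ⟨χ, P, S, hχ, Consistent.memBarP hχ hP0 ?_ hSadp ?_ ?_, ?_⟩
  · have h2 := h.sum_density_last (Nat.zero_le _) (φ := fun _ => 1) fun _ _ _ => rfl
    simp only [one_mul] at h2
    rw [hPdef, h2, ← h.initial]
    refine Finset.sum_congr rfl fun ω _ => ?_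
    rw [← h.survival_mul_density (Nat.zero_le _) ω]
    simp [survival]
  · intro t ω ht
    have h1 := h.exercise_bounds t ω ht
    simp only [hSdef]
    split_ifs with h0
    · exact ⟨le_rfl, M.Sb_le_Sa t ω ht⟩
    · have h2 : 0 < m t ω := lt_of_le_of_ne (h.nonneg t ω).1 (Ne.symm h0)
      rw [le_div_iff₀ h2, div_le_iff₀ h2]
      exact h1
  · intro t ht δ hδ
    have h1 : ∑ ω, P ω * (δ ω * starVal M χ S (t + 1) ω) = ∑ ω, δ ω * l t ω := by
      rw [sum_mul_starVal, hl t ht δ hδ]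
      refine Finset.sum_congr rfl fun s hs => ?_
      obtain ⟨hs1, hs2⟩ := Finset.mem_Icc.1 hs
      exact hn s hs2 δ (hδ.mono (M.F_mono (by omega)))
    have h2 : ∑ ω, P ω * (chiStar M χ (t + 1) ω * liq M t ω 0 (δ ω)) =
        ∑ ω, liq M t ω 0 (δ ω) * k t ω := by
      have h3 := h.sum_density_last ht
        (φ := fun ω => chiStar M χ (t + 1) ω * liq M t ω 0 (δ ω)) fun ω ω' hω => by
          simp only [hχ.atomConst_chiStar_succ ht _ _ hω, liq, hδ _ _ hω,
            atomConst_Sb ht _ _ hω, atomConst_Sa ht _ _ hω]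
      calc _ = ∑ ω, chiStar M χ (t + 1) ω * liq M t ω 0 (δ ω) * density m k M.T ω :=
            Finset.sum_congr rfl fun ω _ => mul_comm _ _
        _ = _ := h3
        _ = _ := Finset.sum_congr rfl fun ω _ => by
          rw [hstar t ht]
          linear_combination liq M t ω 0 (δ ω) *
            h.survival_succ_mul (h.survival_mul_density ht ω)
    rw [h1, h2]
    refine Finset.sum_le_sum fun ω _ => ?_
    have h3 := h.continue_bounds t ω ht
    unfold liq
    rcases le_total 0 (δ ω) with hd | hd
    · rw [max_eq_left hd, max_eq_right (by linarith)]
      nlinarith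
    · rw [max_eq_right hd, max_eq_left (by linarith)]
      nlinarith
  · rw [expect_mixVal]
    refine Finset.sum_congr rfl fun s hs => ?_
    have hs' : s ≤ M.T := Nat.lt_succ_iff.1 (Finset.mem_range.1 hs)
    rw [hm s hs' _ (isAdapted_iff.1 hpay.1 s hs'), hn s hs' _ (isAdapted_iff.1 hpay.2 s hs'),
      ← Finset.sum_add_distrib]

end IsFlow

/-- Predictable processes, extended by one period beyond the horizon. -/
def IsPredictable (M : Market Ω) (α : ℕ → Ω → ℝ) : Prop :=
  ∀ t, t ≤ M.T + 1 → AtomConst (M.F (t - 1)) (α t)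

lemma IsPredictable.adapted {α : ℕ → Ω → ℝ} (h : IsPredictable M α) {t : ℕ} (ht : t ≤ M.T) :
    AtomConst (M.F t) (α t) := (h t (by omega)).mono (M.F_mono (Nat.sub_le _ _))

/-- Tuples `(α, β, x, s)` of predictable strategies, an initial capital and a scale. -/
def strategySpace (M : Market Ω) :
    Submodule ℝ ((ℕ → Ω → ℝ) × (ℕ → Ω → ℝ) × ℝ × ℝ) where
  carrier := {z | IsPredictable M z.1 ∧ IsPredictable M z.2.1}
  add_mem' := fun {_ _} ha hb =>
    ⟨fun t ht ω ω' h => congrArg₂ (· + ·) (ha.1 t ht ω ω' h) (hb.1 t ht ω ω' h),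
      fun t ht ω ω' h => congrArg₂ (· + ·) (ha.2 t ht ω ω' h) (hb.2 t ht ω ω' h)⟩
  zero_mem' := ⟨fun _ _ _ _ _ => rfl, fun _ _ _ _ _ => rfl⟩
  smul_mem' := fun c {_} ha =>
    ⟨fun t ht ω ω' h => congrArg (c * ·) (ha.1 t ht ω ω' h),
      fun t ht ω ω' h => congrArg (c * ·) (ha.2 t ht ω ω' h)⟩

/-- The ask price for `true` and the bid price for `false`. -/
def sidePrice (M : Market Ω) (b : Bool) : ℕ → Ω → ℝ := bif b then M.Sa else M.Sb

lemma atomConst_sidePrice (b : Bool) {t : ℕ} (ht : t ≤ M.T) :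
    AtomConst (M.F t) (sidePrice M b t) := by
  cases b
  · exact atomConst_Sb ht
  · exact atomConst_Sa ht

/-- Value at price `q` of the position left after delivering the scaled payoff. -/
def deliverFun (q ξ ζ : ℕ → Ω → ℝ) (t : ℕ) (ω : Ω) :
    ((ℕ → Ω → ℝ) × (ℕ → Ω → ℝ) × ℝ × ℝ) →ₗ[ℝ] ℝ where
  toFun z := z.1 t ω - z.2.2.2 * ξ t ω + q t ω * (z.2.1 t ω - z.2.2.2 * ζ t ω)
  map_add' a b := by simp; ring
  map_smul' c a := by simp; ring

/-- Value at price `q` of the position released by rebalancing. -/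
def rebalanceFun (q : ℕ → Ω → ℝ) (t : ℕ) (ω : Ω) :
    ((ℕ → Ω → ℝ) × (ℕ → Ω → ℝ) × ℝ × ℝ) →ₗ[ℝ] ℝ where
  toFun z := z.1 t ω - z.1 (t + 1) ω + q t ω * (z.2.1 t ω - z.2.1 (t + 1) ω)
  map_add' a b := by simp; ring
  map_smul' c a := by simp; ring

/-- Capital left after buying the initial position at price `q`. -/
def setupFun (q : ℕ → Ω → ℝ) (ω : Ω) :
    ((ℕ → Ω → ℝ) × (ℕ → Ω → ℝ) × ℝ × ℝ) →ₗ[ℝ] ℝ where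
  toFun z := z.2.2.1 - z.1 0 ω - q 0 ω * z.2.1 0 ω
  map_add' a b := by simp; ring
  map_smul' c a := by simp; ring

/-- The scale coordinate. -/
def scaleFun (Ω : Type*) : ((ℕ → Ω → ℝ) × (ℕ → Ω → ℝ) × ℝ × ℝ) →ₗ[ℝ] ℝ where
  toFun z := z.2.2.2
  map_add' _ _ := rfl
  map_smul' _ _ := rfl

/-- The capital exceeding the scaled price `p`. -/
def excessFun (Ω : Type*) (p : ℝ) : ((ℕ → Ω → ℝ) × (ℕ → Ω → ℝ) × ℝ × ℝ) →ₗ[ℝ] ℝ where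
  toFun z := z.2.2.1 - p * z.2.2.2
  map_add' a b := by simp; ring
  map_smul' c a := by simp; ring

lemma sellerHedge_of_forall {ξ ζ α β : ℕ → Ω → ℝ} (h : SelfFinancing M α β)
    (hd : ∀ t, t ≤ M.T → ∀ ω, 0 ≤ liq M t ω (α t ω - ξ t ω) (β t ω - ζ t ω)) :
    SellerHedge M ξ ζ α β :=
  ⟨h, fun τ hτ ω => hd (τ ω) (hτ.1 ω) ω⟩

/-- Lagrange multipliers for the superhedging problem. -/
lemma exists_multipliers {ξ ζ : ℕ → Ω → ℝ} (hpay : AdaptedPair M ξ ζ) {p : ℝ}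
    (hp : ∀ s : ℝ, 0 ≤ s → ∀ α β,
      SellerHedge M (fun t ω => s * ξ t ω) (fun t ω => s * ζ t ω) α β →
        ∀ ω, p * s ≤ -liq M 0 ω (-α 0 ω) (-β 0 ω)) :
    ∃ (u v : Bool → ℕ → Ω → ℝ) (w : Bool → Ω → ℝ) (c : ℝ),
      (∀ b t, AtomConst (M.F t) (u b t)) ∧ (∀ b t, AtomConst (M.F t) (v b t)) ∧
      (∀ b t ω, 0 ≤ u b t ω) ∧ (∀ b t ω, 0 ≤ v b t ω) ∧ (∀ b ω, 0 ≤ w b ω) ∧ 0 ≤ c ∧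
      ∀ α β, IsPredictable M α → IsPredictable M β → ∀ x s : ℝ, x - p * s =
        ∑ b, ∑ t ∈ Finset.range (M.T + 1), ∑ ω,
          (α t ω - s * ξ t ω + sidePrice M b t ω * (β t ω - s * ζ t ω)) * u b t ω +
        ∑ b, ∑ t ∈ Finset.range (M.T + 1), ∑ ω,
          (α t ω - α (t + 1) ω + sidePrice M b t ω * (β t ω - β (t + 1) ω)) * v b t ω +
        ∑ b, ∑ ω, (x - α 0 ω - sidePrice M b 0 ω * β 0 ω) * w b ω + c * s := by
  have ω₀ : Ω := (nonempty_of_market M).some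
  obtain ⟨y, hy, hid⟩ := farkas_submodule (strategySpace M)
    (ι := (Bool × Fin (M.T + 1) × Ω) ⊕ (Bool × Fin (M.T + 1) × Ω) ⊕ (Bool × Ω) ⊕ Unit)
    (Sum.elim (fun i => deliverFun (sidePrice M i.1) ξ ζ i.2.1 i.2.2)
      (Sum.elim (fun i => rebalanceFun (sidePrice M i.1) i.2.1 i.2.2)
        (Sum.elim (fun i => setupFun (sidePrice M i.1) i.2) (fun _ => scaleFun Ω))))
    (excessFun Ω p) (by
      rintro ⟨α, β, x, s⟩ ⟨hα, hβ⟩ hz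
      dsimp only at hα hβ
      have hd : ∀ b t, t ≤ M.T → ∀ ω,
          0 ≤ α t ω - s * ξ t ω + sidePrice M b t ω * (β t ω - s * ζ t ω) := fun b t ht ω =>
        hz (Sum.inl (b, ⟨t, Nat.lt_succ_of_le ht⟩, ω))
      have hr : ∀ b t, t ≤ M.T → ∀ ω,
          0 ≤ α t ω - α (t + 1) ω + sidePrice M b t ω * (β t ω - β (t + 1) ω) := fun b t ht ω =>
        hz (Sum.inr (Sum.inl (b, ⟨t, Nat.lt_succ_of_le ht⟩, ω)))
      have hi : ∀ b ω, 0 ≤ x - α 0 ω - sidePrice M b 0 ω * β 0 ω := fun b ω =>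
        hz (Sum.inr (Sum.inr (Sum.inl (b, ω))))
      have hs : 0 ≤ s := hz (Sum.inr (Sum.inr (Sum.inr ())))
      have hsf : SelfFinancing M α β := by
        simp only [SelfFinancing, measurable_iff_atomConst]
        exact ⟨hα 0 (Nat.zero_le _), hβ 0 (Nat.zero_le _),
          fun t ht => ⟨hα (t + 1) (by omega), hβ (t + 1) (by omega)⟩,
          fun t ht ω => le_liq (hr false t ht.le ω) (hr true t ht.le ω)⟩
      have h1 := hp s hs α β (sellerHedge_of_forall hsf fun t ht ω =>
        le_liq (hd false t ht ω) (hd true t ht ω)) ω₀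
      have h2 : -x ≤ liq M 0 ω₀ (-α 0 ω₀) (-β 0 ω₀) := by
        have h3 : 0 ≤ x - α 0 ω₀ - M.Sb 0 ω₀ * β 0 ω₀ := hi false ω₀
        have h4 : 0 ≤ x - α 0 ω₀ - M.Sa 0 ω₀ * β 0 ω₀ := hi true ω₀
        exact le_liq (by linarith) (by linarith)
      change 0 ≤ x - p * s
      linarith)
  simp only [Fintype.sum_sum_type, Sum.elim_inl, Sum.elim_inr, Fintype.sum_prod_type,
    Finset.univ_unique, Finset.sum_singleton] at hid
  set u₀ : Bool → ℕ → Ω → ℝ := fun b t ω =>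
    if ht : t < M.T + 1 then y (Sum.inl (b, ⟨t, ht⟩, ω)) else 0 with hu₀
  set v₀ : Bool → ℕ → Ω → ℝ := fun b t ω =>
    if ht : t < M.T + 1 then y (Sum.inr (Sum.inl (b, ⟨t, ht⟩, ω))) else 0 with hv₀
  have hu₀0 : ∀ b t ω, 0 ≤ u₀ b t ω := fun b t ω => by
    simp only [hu₀]; split_ifs <;> simp [hy]
  have hv₀0 : ∀ b t ω, 0 ≤ v₀ b t ω := fun b t ω => by
    simp only [hv₀]; split_ifs <;> simp [hy]
  choose u hu hu0 huφ using fun b t => exists_average (M.F t) (hu₀0 b t)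
  choose v hv hv0 hvφ using fun b t => exists_average (M.F t) (hv₀0 b t)
  refine ⟨u, v, fun b ω => y (Sum.inr (Sum.inr (Sum.inl (b, ω)))),
    y (Sum.inr (Sum.inr (Sum.inr ()))), hu, hv, hu0, hv0, fun b ω => hy _, hy _, ?_⟩
  intro α β hα hβ x s
  have h1 := hid (α, β, x, s) ⟨hα, hβ⟩
  change x - p * s = _ at h1
  rw [h1, ← add_assoc, ← add_assoc]
  congr 1
  · congr 1
    · congr 1
      · refine Finset.sum_congr rfl fun b _ => ?_
        rw [Finset.sum_range]
        refine Finset.sum_congr rfl fun t _ => ?_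
        have ht : (t : ℕ) ≤ M.T := Nat.lt_succ_iff.1 t.2
        rw [huφ]
        · refine Finset.sum_congr rfl fun ω _ => ?_
          simp only [hu₀, t.2, dif_pos, Fin.eta]
          exact mul_comm _ _
        · intro ω ω' hω
          simp only [hα.adapted ht _ _ hω, hβ.adapted ht _ _ hω, atomConst_sidePrice b ht _ _ hω,
            isAdapted_iff.1 hpay.1 t ht _ _ hω, isAdapted_iff.1 hpay.2 t ht _ _ hω]
      · refine Finset.sum_congr rfl fun b _ => ?_
        rw [Finset.sum_range]
        refine Finset.sum_congr rfl fun t _ => ?_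
        have ht : (t : ℕ) ≤ M.T := Nat.lt_succ_iff.1 t.2
        rw [hvφ]
        · refine Finset.sum_congr rfl fun ω _ => ?_
          simp only [hv₀, t.2, dif_pos, Fin.eta]
          exact mul_comm _ _
        · intro ω ω' hω
          simp only [hα.adapted ht _ _ hω, hβ.adapted ht _ _ hω, atomConst_sidePrice b ht _ _ hω,
            hα (t + 1) (Nat.succ_le_succ ht) _ _ hω, hβ (t + 1) (Nat.succ_le_succ ht) _ _ hω]
    · exact Finset.sum_congr rfl fun b _ => Finset.sum_congr rfl fun ω _ => mul_comm _ _

lemma sum_range_mul_ite (a : ℕ → Ω → ℝ) (φ : Ω → ℝ) (N r : ℕ) :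
    ∑ s ∈ Finset.range N, ∑ ω, (if s = r then φ ω else 0) * a s ω =
      if r < N then ∑ ω, φ ω * a r ω else 0 := by
  split_ifs with h
  · rw [Finset.sum_eq_single_of_mem r (Finset.mem_range.2 h) fun s _ hs =>
      Finset.sum_eq_zero fun ω _ => by rw [if_neg hs, zero_mul]]
    simp
  · refine Finset.sum_eq_zero fun s hs => Finset.sum_eq_zero fun ω _ => ?_
    rw [if_neg (by rintro rfl; exact h (Finset.mem_range.1 hs)), zero_mul]

/-- The conservation laws encoded by the Lagrangian identity. -/
lemma conservation {a k : ℕ → Ω → ℝ} {w : Ω → ℝ}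
    (h : ∀ α, IsPredictable M α →
      ∑ t ∈ Finset.range (M.T + 1), ∑ ω, α t ω * a t ω +
        ∑ t ∈ Finset.range (M.T + 1), ∑ ω, (α t ω - α (t + 1) ω) * k t ω = ∑ ω, α 0 ω * w ω) :
    (∑ ω, (a 0 ω + k 0 ω) = ∑ ω, w ω) ∧ ∑ ω, k M.T ω = 0 ∧
      ∀ t, t < M.T → ∀ φ, AtomConst (M.F t) φ →
        ∑ ω, φ ω * (a (t + 1) ω + k (t + 1) ω) = ∑ ω, φ ω * k t ω := by
  have key : ∀ r φ, AtomConst (M.F (r - 1)) φ →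
      (if r < M.T + 1 then ∑ ω, φ ω * a r ω else 0) +
        ((if r < M.T + 1 then ∑ ω, φ ω * k r ω else 0) -
          ∑ t ∈ Finset.range (M.T + 1), ∑ ω, (if t + 1 = r then φ ω else 0) * k t ω) =
      ∑ ω, (if 0 = r then φ ω else 0) * w ω := by
    intro r φ hφ
    have h1 := h (fun t ω => if t = r then φ ω else 0) fun t _ ω ω' hω => by
      dsimp only
      split_ifs with htr
      · subst htr; exact hφ _ _ hω
      · rfl
    simp only [sub_mul, Finset.sum_sub_distrib, sum_range_mul_ite] at h1
    exact h1
  refine ⟨?_, ?_, fun t ht φ hφ => ?_⟩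
  · have := key 0 (fun _ => 1) fun _ _ _ => rfl
    simp only [if_true, one_mul, Nat.succ_ne_zero, if_false, zero_mul,
      Finset.sum_const_zero, sub_zero, Nat.zero_lt_succ] at this
    rw [Finset.sum_add_distrib, this]
  · have := key (M.T + 1) (fun _ => 1) fun _ _ _ => rfl
    simp only [add_left_inj, sum_range_mul_ite, lt_irrefl, if_false, Nat.lt_succ_self, if_true,
      one_mul, (Nat.succ_ne_zero _).symm, zero_mul, Finset.sum_const_zero] at this
    linarith
  · have := key (t + 1) φ hφ
    simp only [add_left_inj, sum_range_mul_ite, add_lt_add_iff_right, ht, ht.trans (Nat.lt_succ_self _),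
      if_true, (Nat.succ_ne_zero _).symm, if_false, zero_mul, Finset.sum_const_zero] at this
    simp only [mul_add, Finset.sum_add_distrib]
    linarith

/-- Strong duality: some flow attains any lower bound of the superhedging costs. -/
lemma exists_flow {ξ ζ : ℕ → Ω → ℝ} (hpay : AdaptedPair M ξ ζ) {p : ℝ}
    (hp : ∀ s : ℝ, 0 ≤ s → ∀ α β,
      SellerHedge M (fun t ω => s * ξ t ω) (fun t ω => s * ζ t ω) α β →
        ∀ ω, p * s ≤ -liq M 0 ω (-α 0 ω) (-β 0 ω)) :
    ∃ m n k l, IsFlow M m n k l ∧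
      p ≤ ∑ t ∈ Finset.range (M.T + 1), ∑ ω, (ξ t ω * m t ω + ζ t ω * n t ω) := by
  obtain ⟨u, v, w, c, hu, hv, hu0, hv0, hw0, hc, hid⟩ := exists_multipliers hpay hp
  have hz : IsPredictable M fun _ _ => 0 := fun _ _ _ _ _ => rfl
  simp only [Fintype.sum_bool, sidePrice, cond_true, cond_false] at hid
  have hmass := conservation (M := M) (a := fun t ω => u true t ω + u false t ω)
    (k := fun t ω => v true t ω + v false t ω) (w := fun ω => w true ω + w false ω) (by
      intro α hα
      have h1 := hid α _ hα hz 0 0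
      simp only [mul_zero, zero_mul, sub_zero, add_zero, zero_sub, neg_mul,
        Finset.sum_neg_distrib] at h1
      simp only [mul_add, Finset.sum_add_distrib]
      linarith)
  have hvalue := conservation (M := M)
    (a := fun t ω => M.Sa t ω * u true t ω + M.Sb t ω * u false t ω)
    (k := fun t ω => M.Sa t ω * v true t ω + M.Sb t ω * v false t ω)
    (w := fun ω => M.Sa 0 ω * w true ω + M.Sb 0 ω * w false ω) (by
      intro β hβ
      have h1 := hid _ β hz hβ 0 0
      simp only [mul_zero, zero_mul, sub_zero, add_zero, zero_sub, neg_mul, zero_add,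
        Finset.sum_neg_distrib] at h1
      simp only [mul_add, Finset.sum_add_distrib, mul_left_comm (β _ _), mul_assoc,
        mul_left_comm (β _ _ - β _ _)] at h1 ⊢
      linarith)
  have hw1 : ∑ ω, (w true ω + w false ω) = 1 := by
    have h1 := hid _ _ hz hz 1 0
    simp only [mul_zero, zero_mul, sub_zero, add_zero, zero_add, one_mul,
      Finset.sum_const_zero] at h1
    rw [Finset.sum_add_distrib, ← h1]
  have hobj := hid _ _ hz hz 0 1
  refine ⟨fun t ω => u true t ω + u false t ω,
    fun t ω => M.Sa t ω * u true t ω + M.Sb t ω * u false t ω,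
    fun t ω => v true t ω + v false t ω,
    fun t ω => M.Sa t ω * v true t ω + M.Sb t ω * v false t ω, ?_, ?_⟩
  · constructor
    · refine fun t ht => ⟨?_, ?_, ?_, ?_⟩ <;> intro ω ω' hω <;>
        simp only [hu _ t _ _ hω, hv _ t _ _ hω, atomConst_Sa ht _ _ hω, atomConst_Sb ht _ _ hω]
    · exact fun t ω => ⟨add_nonneg (hu0 _ _ _) (hu0 _ _ _), add_nonneg (hv0 _ _ _) (hv0 _ _ _)⟩
    · intro t ω ht
      have h1 := mul_le_mul_of_nonneg_right (M.Sb_le_Sa t ω ht) (hu0 true t ω)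
      have h2 := mul_le_mul_of_nonneg_right (M.Sb_le_Sa t ω ht) (hu0 false t ω)
      constructor <;> linarith
    · intro t ω ht
      have h1 := mul_le_mul_of_nonneg_right (M.Sb_le_Sa t ω ht) (hv0 true t ω)
      have h2 := mul_le_mul_of_nonneg_right (M.Sb_le_Sa t ω ht) (hv0 false t ω)
      constructor <;> linarith
    · rw [hmass.1, hw1]
    · exact hmass.2.2
    · exact hvalue.2.2
    · exact fun ω => (Finset.sum_eq_zero_iff_of_nonneg fun ω _ =>
        add_nonneg (hv0 true M.T ω) (hv0 false M.T ω)).1 hmass.2.1 ω (Finset.mem_univ _)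
  · have h1 : ∑ t ∈ Finset.range (M.T + 1), ∑ ω, (ξ t ω * (u true t ω + u false t ω) +
        ζ t ω * (M.Sa t ω * u true t ω + M.Sb t ω * u false t ω)) =
        -(∑ t ∈ Finset.range (M.T + 1), ∑ ω,
            (0 - 1 * ξ t ω + M.Sa t ω * (0 - 1 * ζ t ω)) * u true t ω +
          ∑ t ∈ Finset.range (M.T + 1), ∑ ω,
            (0 - 1 * ξ t ω + M.Sb t ω * (0 - 1 * ζ t ω)) * u false t ω) := by
      simp only [← Finset.sum_add_distrib, ← Finset.sum_neg_distrib]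
      exact Finset.sum_congr rfl fun t _ => Finset.sum_congr rfl fun ω _ => by ring
    rw [h1]
    simp only [mul_zero, zero_mul, sub_zero, add_zero, Finset.sum_const_zero, mul_one] at hobj ⊢
    linarith

lemma SellerHedge.mul {ξ ζ α β : ℕ → Ω → ℝ} (h : SellerHedge M ξ ζ α β) {c : ℝ} (hc : 0 ≤ c) :
    SellerHedge M (fun t ω => c * ξ t ω) (fun t ω => c * ζ t ω) (fun t ω => c * α t ω)
      (fun t ω => c * β t ω) := by
  obtain ⟨⟨h1, h2, h3, h4⟩, h5⟩ := h
  refine ⟨⟨h1.const_mul c, h2.const_mul c,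
    fun t ht => ⟨(h3 t ht).1.const_mul c, (h3 t ht).2.const_mul c⟩, fun t ht ω => ?_⟩,
    fun τ hτ ω => ?_⟩
  · rw [← mul_sub, ← mul_sub, liq_mul hc]
    exact mul_nonneg hc (h4 t ht ω)
  · rw [← mul_sub, ← mul_sub, liq_mul hc]
    exact mul_nonneg hc (h5 τ hτ ω)

lemma exists_sellerHedge (M : Market Ω) (ξ ζ : ℕ → Ω → ℝ) : ∃ α β, SellerHedge M ξ ζ α β := by
  set B : ℝ := ∑ t ∈ Finset.range (M.T + 1), ∑ ω, (|ξ t ω| + |ζ t ω|) with hB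
  have hle : ∀ t, t ≤ M.T → ∀ ω, |ξ t ω| + |ζ t ω| ≤ B := fun t ht ω => by
    have hnn : ∀ t ω, 0 ≤ |ξ t ω| + |ζ t ω| := fun t ω => by positivity
    refine (Finset.single_le_sum (f := fun ω => |ξ t ω| + |ζ t ω|) (fun ω _ => hnn t ω)
      (Finset.mem_univ ω)).trans ?_
    exact Finset.single_le_sum (f := fun t => ∑ ω, (|ξ t ω| + |ζ t ω|))
      (fun t _ => Finset.sum_nonneg fun ω _ => hnn t ω) (Finset.mem_range.2 (Nat.lt_succ_of_le ht))
  refine ⟨fun _ _ => B, fun _ _ => B, sellerHedge_of_forall ⟨measurable_const, measurable_const,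
    fun _ _ => ⟨measurable_const, measurable_const⟩, fun t _ ω => by simp [liq]⟩ ?_⟩
  intro t ht ω
  have h1 := hle t ht ω
  have h2 : 0 ≤ B - ξ t ω := by linarith [le_abs_self (ξ t ω), abs_nonneg (ζ t ω)]
  have h3 : 0 ≤ B - ζ t ω := by linarith [le_abs_self (ζ t ω), abs_nonneg (ξ t ω)]
  have hb := (M.Sb_pos t ω ht).le
  exact le_liq (add_nonneg h2 (mul_nonneg hb h3))
    (add_nonneg h2 (mul_nonneg (hb.trans (M.Sb_le_Sa t ω ht)) h3))

lemma expect_le_askPrice {ξ ζ χ S : ℕ → Ω → ℝ} {P : Ω → ℝ} (hχ : IsMixedStop M χ)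
    (hPS : memBarP M χ P S) :
    expect P (mixVal M χ fun t ω => ξ t ω + S t ω * ζ t ω) ≤ askPrice M ξ ζ := by
  have ω₀ : Ω := (nonempty_of_market M).some
  obtain ⟨α, β, h⟩ := exists_sellerHedge M ξ ζ
  refine le_csInf ⟨_, α, β, h, fun ω => h.cost_eq ω₀ ω⟩ ?_
  rintro x ⟨α, β, h, hx⟩
  rw [hx ω₀]
  exact expect_le_cost h hχ hPS ω₀

lemma isMixedStop_last (M : Market Ω) : IsMixedStop M fun t _ => if t = M.T then 1 else 0 :=
  ⟨fun _ _ => measurable_const, fun t _ => by dsimp only; split_ifs <;> norm_num,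
    fun _ => by simp⟩

lemma askPrice_le_cost {ξ ζ α β : ℕ → Ω → ℝ} (hNA : ArbitrageFree M)
    (h : SellerHedge M ξ ζ α β) (ω : Ω) :
    askPrice M ξ ζ ≤ -liq M 0 ω (-α 0 ω) (-β 0 ω) := by
  obtain ⟨P, S, hPS⟩ := exists_memP_of_arbitrageFree hNA
  have hχ := isMixedStop_last M
  refine csInf_le ⟨expect P (mixVal M (fun t _ => if t = M.T then 1 else 0)
    fun t ω => ξ t ω + S t ω * ζ t ω), ?_⟩ ⟨α, β, h, fun ω' => h.cost_eq ω ω'⟩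
  rintro x ⟨α, β, h, hx⟩
  rw [hx ω]
  exact expect_le_cost h hχ (hPS _ hχ).1 ω

lemma askPrice_mul_le_cost {ξ ζ : ℕ → Ω → ℝ} (hNA : ArbitrageFree M) (s : ℝ) (hs : 0 ≤ s)
    (α β : ℕ → Ω → ℝ)
    (h : SellerHedge M (fun t ω => s * ξ t ω) (fun t ω => s * ζ t ω) α β) (ω : Ω) :
    askPrice M ξ ζ * s ≤ -liq M 0 ω (-α 0 ω) (-β 0 ω) := by
  rcases hs.eq_or_lt with rfl | hs
  · obtain ⟨P, S, hPS⟩ := exists_memP_of_arbitrageFree hNA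
    have hχ := isMixedStop_last M
    have h1 := expect_le_cost h hχ (hPS _ hχ).1 ω
    simp only [zero_mul, mul_zero, add_zero, expect, mixVal, Finset.sum_const_zero] at h1
    rwa [mul_zero]
  · have h1 := h.mul (inv_nonneg.2 hs.le)
    simp only [inv_mul_cancel_left₀ hs.ne'] at h1
    have h2 := askPrice_le_cost hNA h1 ω
    rw [← mul_neg, ← mul_neg, liq_mul (inv_nonneg.2 hs.le), ← mul_neg, mul_comm,
      ← div_eq_mul_inv, le_div_iff₀ hs] at h2
    exact h2

/-- The price is attained by a pair whose measure may fail to be equivalent to `Q`. -/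
lemma exists_askPrice_le_expect {ξ ζ : ℕ → Ω → ℝ} (hpay : AdaptedPair M ξ ζ)
    (hNA : ArbitrageFree M) :
    ∃ χ P S, IsMixedStop M χ ∧ memBarP M χ P S ∧
      askPrice M ξ ζ ≤ expect P (mixVal M χ fun t ω => ξ t ω + S t ω * ζ t ω) := by
  obtain ⟨m, n, k, l, hflow, hle⟩ := exists_flow hpay (askPrice_mul_le_cost hNA)
  obtain ⟨χ, P, S, hχ, hPS, heq⟩ := hflow.exists_pair hpay
  exact ⟨χ, P, S, hχ, hPS, heq ▸ hle⟩

/-- The price is the least upper bound over equivalent measures for some mixed stopping time. -/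
lemma exists_isLUB {ξ ζ : ℕ → Ω → ℝ} (hpay : AdaptedPair M ξ ζ) (hNA : ArbitrageFree M) :
    ∃ χ, IsMixedStop M χ ∧ IsLUB {x | ∃ P S, memP M χ P S ∧
      x = expect P (mixVal M χ fun t ω => ξ t ω + S t ω * ζ t ω)} (askPrice M ξ ζ) := by
  obtain ⟨χ, P, S, hχ, hPS, hle⟩ := exists_askPrice_le_expect hpay hNA
  obtain ⟨P', S', hPS'⟩ := exists_memP_of_arbitrageFree hNA
  refine ⟨χ, hχ, ?_, fun b hb => ?_⟩
  · rintro x ⟨P'', S'', h, rfl⟩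
    exact expect_le_askPrice hχ h.1
  · set e := expect P (mixVal M χ fun t ω => ξ t ω + S t ω * ζ t ω)
    set e' := expect P' (mixVal M χ fun t ω => ξ t ω + S' t ω * ζ t ω)
    have hmix : ∀ ε ∈ Set.Ioc (0 : ℝ) 1, (1 - ε) * e + ε * e' ≤ b := fun ε hε => by
      obtain ⟨P'', S'', h, heq⟩ := exists_mix hχ hPS (hPS' χ hχ) hpay hε.1 hε.2
      exact heq ▸ hb ⟨P'', S'', h, rfl⟩
    have hlim : Filter.Tendsto (fun ε : ℝ => (1 - ε) * e + ε * e') (nhdsWithin 0 (Set.Ioi 0))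
        (nhds e) := by
      have hcont : Continuous fun ε : ℝ => (1 - ε) * e + ε * e' := by fun_prop
      have := hcont.tendsto 0
      simp only [sub_zero, one_mul, zero_mul, add_zero] at this
      exact this.mono_left nhdsWithin_le_nhds
    refine hle.trans (le_of_tendsto hlim ?_)
    filter_upwards [Ioc_mem_nhdsGT (zero_lt_one' ℝ)] with ε hε using hmix ε hε

variable (M)

/-- Theorem: π^a(ξ,ζ) = sup over mixed stopping times χ of the supremum over
(P,S) ∈ P(χ) of E_P((ξ + Sζ)_χ), and the supremum over χ is attained. -/
theorem seller_price_sup_over_equivalent (ξ ζ : ℕ → Ω → ℝ)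
    (hpay : AdaptedPair M ξ ζ) (hNA : ArbitrageFree M) :
    askPrice M ξ ζ =
      sSup {x | ∃ χ P S, IsMixedStop M χ ∧ memP M χ P S ∧
        x = expect P (mixVal M χ fun t ω => ξ t ω + S t ω * ζ t ω)} ∧
    ∃ χ, IsMixedStop M χ ∧
      askPrice M ξ ζ = sSup {x | ∃ P S, memP M χ P S ∧
        x = expect P (mixVal M χ fun t ω => ξ t ω + S t ω * ζ t ω)} := by
  obtain ⟨χ, hχ, hlub⟩ := exists_isLUB hpay hNA
  obtain ⟨P, S, hPS⟩ := exists_memP_of_arbitrageFree hNA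
  refine ⟨Eq.symm (IsLUB.csSup_eq ⟨?_, fun b hb => hlub.2 ?_⟩ ⟨_, χ, P, S, hχ, hPS χ hχ, rfl⟩),
    χ, hχ, (hlub.csSup_eq ⟨_, P, S, hPS χ hχ, rfl⟩).symm⟩
  · rintro x ⟨χ', P', S', hχ', h, rfl⟩
    exact expect_le_askPrice hχ' h.1
  · rintro x ⟨P', S', h, rfl⟩
    exact hb ⟨χ, P', S', hχ, h, rfl⟩

end RZ
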